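/- arXiv:0806.2788 — 2 statements merged into one kernel-verified Lean document; each statement's English description precedes it below -/
import Mathlib

section
/- Let R = R₁ * R₂ * R₃ be a free product decomposition of a countable Borel equivalence relation on a standard Borel space X. If S₁ is a subrelation of R₁ and S₂ is a subrelation of R₂ which are inner conjugate in R, then S₁ and S₂ are smooth. -/
open MeasureTheory

/-- A countable Borel equivalence relation on `X`, defined on a Borel domain `dom`:
it is Borel as a subset of `X × X`, is an equivalence relation on `dom`, and has
countable classes. -/
structure CBER (X : Type) [MeasurableSpace X] where
  dom : Set X
  dom_meas : MeasurableSet dom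
  rel : X → X → Prop
  rel_meas : MeasurableSet {p : X × X | rel p.1 p.2}
  rel_dom : ∀ {x y : X}, rel x y → x ∈ dom ∧ y ∈ dom
  refl : ∀ x ∈ dom, rel x x
  symm : ∀ {x y : X}, rel x y → rel y x
  trans : ∀ {x y z : X}, rel x y → rel y z → rel x z
  countable_classes : ∀ x : X, {y | rel x y}.Countable

/-- The class of `x`. -/
def CBER.cls {X : Type} [MeasurableSpace X] (R : CBER X) (x : X) : Set X := {y | R.rel x y}

/-- The `R`-saturation of a set `A`: the union of the `R`-classes meeting `A`. -/
def CBER.sat {X : Type} [MeasurableSpace X] (R : CBER X) (A : Set X) : Set X :=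
  {y | ∃ x ∈ A, R.rel x y}

/-- A complete section: a Borel subset of the domain meeting every class. -/
def CBER.IsCompleteSection {X : Type} [MeasurableSpace X] (R : CBER X) (A : Set X) : Prop :=
  MeasurableSet A ∧ A ⊆ R.dom ∧ ∀ x ∈ R.dom, ∃ y ∈ A, R.rel x y

/-- A smooth CBER: one admitting a Borel fundamental domain (a Borel set meeting
every class exactly once). -/
def CBER.Smooth {X : Type} [MeasurableSpace X] (R : CBER X) : Prop :=
  ∃ D : Set X, MeasurableSet D ∧ D ⊆ R.dom ∧ ∀ x ∈ R.dom, ∃! y, y ∈ D ∧ R.rel x y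

/-- Smoothness of the restriction `R|A`. -/
def CBER.SmoothOn {X : Type} [MeasurableSpace X] (R : CBER X) (A : Set X) : Prop :=
  ∃ D : Set X, MeasurableSet D ∧ D ⊆ A ∧ ∀ x ∈ R.dom ∩ A, ∃! y, y ∈ D ∧ R.rel x y

/-- All classes are finite. -/
def CBER.FiniteClasses {X : Type} [MeasurableSpace X] (R : CBER X) : Prop :=
  ∀ x ∈ R.dom, (R.cls x).Finite

/-- Aperiodic: all classes are infinite (on the domain). -/
def CBER.Aperiodic {X : Type} [MeasurableSpace X] (R : CBER X) : Prop :=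
  ∀ x ∈ R.dom, (R.cls x).Infinite

/-- Trivial: all classes are singletons. -/
def CBER.TrivialClasses {X : Type} [MeasurableSpace X] (R : CBER X) : Prop :=
  ∀ x y, R.rel x y → x = y

/-- The restriction `R|U` of `R` to a Borel set `U`. -/
def CBER.restrict {X : Type} [MeasurableSpace X] (R : CBER X) (U : Set X)
    (hU : MeasurableSet U) : CBER X where
  dom := R.dom ∩ U
  dom_meas := R.dom_meas.inter hU
  rel x y := R.rel x y ∧ x ∈ U ∧ y ∈ U
  rel_meas := by
    have h : {p : X × X | R.rel p.1 p.2 ∧ p.1 ∈ U ∧ p.2 ∈ U} =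
        {p : X × X | R.rel p.1 p.2} ∩ (Prod.fst ⁻¹' U ∩ Prod.snd ⁻¹' U) := by
      ext p
      simp only [Set.mem_setOf_eq, Set.mem_inter_iff, Set.mem_preimage, and_assoc]
    rw [h]
    exact R.rel_meas.inter ((measurable_fst hU).inter (measurable_snd hU))
  rel_dom := fun h => ⟨⟨(R.rel_dom h.1).1, h.2.1⟩, ⟨(R.rel_dom h.1).2, h.2.2⟩⟩
  refl := fun x hx => ⟨R.refl x hx.1, hx.2, hx.2⟩
  symm := fun h => ⟨R.symm h.1, h.2.2, h.2.1⟩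
  trans := fun h h' => ⟨R.trans h.1 h'.1, h.2.1, h'.2.2⟩
  countable_classes := fun x =>
    Set.Countable.mono (fun y hy => hy.1) (R.countable_classes x)

/-- `S` is a subrelation of `R`. -/
def CBER.IsSubrelOf {X : Type} [MeasurableSpace X] (S R : CBER X) : Prop :=
  S.dom ⊆ R.dom ∧ ∀ x y, S.rel x y → R.rel x y

/-- A partial Borel isomorphism between Borel subsets `src` and `tgt` of `X`. -/
structure PBI (X : Type) [MeasurableSpace X] where
  src : Set X
  tgt : Set X
  src_meas : MeasurableSet src
  tgt_meas : MeasurableSet tgt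
  toFun : X → X
  invFun : X → X
  meas_toFun : Measurable toFun
  meas_invFun : Measurable invFun
  mapsTo : Set.MapsTo toFun src tgt
  mapsTo_inv : Set.MapsTo invFun tgt src
  left_inv : ∀ x ∈ src, invFun (toFun x) = x
  right_inv : ∀ y ∈ tgt, toFun (invFun y) = y

/-- Membership in the full pseudogroup `[[R]]`: a partial Borel isomorphism whose
graph is contained in `R`. -/
def CBER.InPseudogroup {X : Type} [MeasurableSpace X] (R : CBER X) (φ : PBI X) : Prop :=
  φ.src ⊆ R.dom ∧ ∀ x ∈ φ.src, R.rel x (φ.toFun x)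

/-- Two subrelations `S₁`, `S₂` of `R` are inner conjugate in `R` if some element of the
full pseudogroup of `R` with domain `D(S₂)` and target `D(S₁)` conjugates one to the other. -/
def InnerConjugate {X : Type} [MeasurableSpace X] (R S₁ S₂ : CBER X) : Prop :=
  ∃ φ : PBI X, R.InPseudogroup φ ∧ φ.src = S₂.dom ∧ φ.tgt = S₁.dom ∧
    ∀ x ∈ φ.src, ∀ y ∈ φ.src, (S₂.rel x y ↔ S₁.rel (φ.toFun x) (φ.toFun y))

/-- `R` preserves the measure `μ`: every element of its full pseudogroup preserves `μ`. -/
def CBER.IsPMP {X : Type} [MeasurableSpace X] (R : CBER X) (μ : Measure X) : Prop :=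
  ∀ φ : PBI X, R.InPseudogroup φ → ∀ A : Set X, A ⊆ φ.src → MeasurableSet A →
    μ (φ.toFun '' A) = μ A

/-- Free independence of a family of equivalence relations: any cycle alternating
nontrivially among the factors must have two consecutive steps in the same factor. -/
def FreelyIndep {X : Type} [MeasurableSpace X] {ι : Type} (Rf : ι → CBER X) : Prop :=
  ∀ (n : ℕ) (x : ℕ → X) (i : ℕ → ι), 2 ≤ n → x n = x 0 →
    (∀ j < n, x j ≠ x (j + 1)) → (∀ j < n, (Rf (i j)).rel (x j) (x (j + 1))) →
    ∃ j, j + 1 < n ∧ i j = i (j + 1)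

/-- `R` is the free product of the family `Rf`: the family is freely independent and `R`
is the smallest equivalence relation on the union of the domains containing every `Rf i`. -/
def IsFreeProduct {X : Type} [MeasurableSpace X] {ι : Type} (R : CBER X)
    (Rf : ι → CBER X) : Prop :=
  FreelyIndep Rf ∧ R.dom = (⋃ i, (Rf i).dom) ∧
    ∀ x y, R.rel x y ↔
      (x ∈ R.dom ∧ Relation.EqvGen (fun a b => ∃ i, (Rf i).rel a b) x y)

/-- The partition `U = ⊔ⱼ Uⱼ` trivializes the free product decomposition `R = *ⱼ Rf j`:
`U` is a complete section for `R`, the partition is `R|U`-invariant, and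
`R|Uⱼ = (Rf j)|Uⱼ` for every `j`. -/
def Trivializes {X : Type} [MeasurableSpace X] {ι : Type}
    (R : CBER X) (Rf : ι → CBER X) (U : ι → Set X) : Prop :=
  (∀ j, MeasurableSet (U j)) ∧ (∀ j, U j ⊆ R.dom) ∧
  Pairwise (Function.onFun Disjoint U) ∧
  (∀ x ∈ R.dom, ∃ y ∈ ⋃ j, U j, R.rel x y) ∧
  (∀ i j : ι, ∀ x ∈ U i, ∀ y ∈ U j, R.rel x y → i = j) ∧
  (∀ j, ∀ x ∈ U j, ∀ y ∈ U j, (R.rel x y ↔ (Rf j).rel x y))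

/-- A free product decomposition is inessential if it admits a trivialization. -/
def Inessential {X : Type} [MeasurableSpace X] {ι : Type}
    (R : CBER X) (Rf : ι → CBER X) : Prop :=
  ∃ U : ι → Set X, Trivializes R Rf U

/-- Freely indecomposable (Borel context): every free product decomposition is inessential. -/
def FreelyIndecomposable {X : Type} [MeasurableSpace X] (R : CBER X) : Prop :=
  ∀ (ι : Type) (_ : Countable ι) (Rf : ι → CBER X), IsFreeProduct R Rf → Inessential R Rf

/-- Inessential decomposition in the measured context: a trivialization up to `μ`-null sets. -/
def InessentialMod {X : Type} [MeasurableSpace X] (μ : Measure X) {ι : Type}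
    (R : CBER X) (Rf : ι → CBER X) : Prop :=
  ∃ (U : ι → Set X) (C : Set X),
    (∀ j, MeasurableSet (U j)) ∧ (∀ j, U j ⊆ R.dom) ∧
    Pairwise (Function.onFun Disjoint U) ∧
    MeasurableSet C ∧ μ Cᶜ = 0 ∧
    (∀ x ∈ R.dom ∩ C, ∃ y ∈ ⋃ j, U j, R.rel x y) ∧
    (∀ i j : ι, ∀ x ∈ U i ∩ C, ∀ y ∈ U j ∩ C, R.rel x y → i = j) ∧
    (∀ j, ∀ x ∈ U j ∩ C, ∀ y ∈ U j ∩ C, (R.rel x y ↔ (Rf j).rel x y))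

/-- Freely indecomposable (measured context): every free product decomposition is
inessential up to `μ`-null sets. -/
def FreelyIndecomposableMod {X : Type} [MeasurableSpace X] (μ : Measure X)
    (R : CBER X) : Prop :=
  ∀ (ι : Type) (_ : Countable ι) (Rf : ι → CBER X), IsFreeProduct R Rf →
    InessentialMod μ R Rf

/-- One step of a word in a graphing: apply `φ` (if `e = true`) or `φ⁻¹` (if `e = false`). -/
def PBIStep {X : Type} [MeasurableSpace X] (φ : PBI X) : Bool → X → X → Prop
  | true, a, b => a ∈ φ.src ∧ φ.toFun a = b
  | false, a, b => a ∈ φ.tgt ∧ φ.invFun a = b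

/-- A treeing: any cyclic word in the generators and their inverses admits a reduction. -/
def IsTreeing {X : Type} [MeasurableSpace X] {ι : Type} (Φ : ι → PBI X) : Prop :=
  ∀ (n : ℕ) (i : ℕ → ι) (ε : ℕ → Bool) (x : ℕ → X),
    0 < n → x n = x 0 → (∀ j < n, PBIStep (Φ (i j)) (ε j) (x j) (x (j + 1))) →
    ∃ j, j + 1 < n ∧ i j = i (j + 1) ∧ ε j ≠ ε (j + 1)

/-- The graphing `Φ` generates `R`: `R` is the smallest equivalence relation on the union of
the sources and targets containing the graphs of the `Φ i`. -/
def GeneratesCBER {X : Type} [MeasurableSpace X] {ι : Type} (Φ : ι → PBI X)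
    (R : CBER X) : Prop :=
  R.dom = (⋃ i, ((Φ i).src ∪ (Φ i).tgt)) ∧ (∀ i, R.InPseudogroup (Φ i)) ∧
    ∀ x y, R.rel x y ↔ (x ∈ R.dom ∧
      Relation.EqvGen (fun a b => ∃ i, a ∈ (Φ i).src ∧ (Φ i).toFun a = b) x y)

/-- Treeable: generated by some (countable) treeing. -/
def CBER.Treeable {X : Type} [MeasurableSpace X] (R : CBER X) : Prop :=
  ∃ Φ : ℕ → PBI X, IsTreeing Φ ∧ GeneratesCBER Φ R

/-- Hyperfinite: increasing union of finite Borel subrelations. -/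
def CBER.Hyperfinite {X : Type} [MeasurableSpace X] (R : CBER X) : Prop :=
  ∃ S : ℕ → CBER X, (∀ n, (S n).IsSubrelOf R) ∧ (∀ n, (S n).FiniteClasses) ∧
    (∀ n, (S n).dom = R.dom) ∧ (∀ n, ∀ x y, (S n).rel x y → (S (n + 1)).rel x y) ∧
    ∀ x y, R.rel x y → ∃ n, (S n).rel x y

/-- Ergodicity of a measured CBER: every invariant Borel set is null or conull. -/
def ErgodicCBER {X : Type} [MeasurableSpace X] (R : CBER X) (μ : Measure X) : Prop :=
  ∀ A : Set X, MeasurableSet A → (∀ x ∈ A, ∀ y, R.rel x y → y ∈ A) →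
    μ A = 0 ∨ μ Aᶜ = 0

/-- A stable orbit equivalence between measured CBERs: a Borel isomorphism between
complete sections (mod null sets), sending the normalized measure to the normalized
measure, and preserving the relations a.e. -/
structure SOEquiv {X Y : Type} [MeasurableSpace X] [MeasurableSpace Y]
    (R : CBER X) (μ : Measure X) (S : CBER Y) (ν : Measure Y) where
  A : Set X
  B : Set Y
  toFun : X → Y
  invFun : Y → X
  measA : MeasurableSet A
  measB : MeasurableSet B
  A_sub : A ⊆ R.dom
  B_sub : B ⊆ S.dom
  A_pos : 0 < μ A
  B_pos : 0 < ν B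
  A_section : ∀ᵐ x ∂μ, x ∈ R.dom → ∃ y ∈ A, R.rel x y
  B_section : ∀ᵐ y ∂ν, y ∈ S.dom → ∃ z ∈ B, S.rel y z
  meas_toFun : Measurable toFun
  meas_invFun : Measurable invFun
  mapsTo : Set.MapsTo toFun A B
  mapsTo_inv : Set.MapsTo invFun B A
  left_inv : ∀ x ∈ A, invFun (toFun x) = x
  right_inv : ∀ y ∈ B, toFun (invFun y) = y
  measure_eq : ∀ E : Set X, E ⊆ A → MeasurableSet E →
    (μ A)⁻¹ * μ E = (ν B)⁻¹ * ν (toFun '' E)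
  rel_iff : ∃ C : Set X, MeasurableSet C ∧ μ (A \ C) = 0 ∧
    ∀ x ∈ A ∩ C, ∀ y ∈ A ∩ C, (R.rel x y ↔ S.rel (toFun x) (toFun y))

/-- Stable orbit equivalence. -/
def SOE {X Y : Type} [MeasurableSpace X] [MeasurableSpace Y]
    (R : CBER X) (μ : Measure X) (S : CBER Y) (ν : Measure Y) : Prop :=
  Nonempty (SOEquiv R μ S ν)

/-- Orbit equivalence: a stable orbit equivalence where one can take the complete
sections to be the full spaces. -/
def OE {X Y : Type} [MeasurableSpace X] [MeasurableSpace Y]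
    (R : CBER X) (μ : Measure X) (S : CBER Y) (ν : Measure Y) : Prop :=
  ∃ E : SOEquiv R μ S ν, E.A = Set.univ ∧ E.B = Set.univ

/-- A probability measure preserving action of a group `G` on a measured space. -/
structure PMPAction (G : Type) [Group G] (X : Type) [MeasurableSpace X]
    (μ : Measure X) where
  act : G → X → X
  act_one : ∀ x, act 1 x = x
  act_mul : ∀ g h x, act (g * h) x = act g (act h x)
  measurePreserving : ∀ g, MeasurePreserving (act g) μ μ

/-- Essential freeness: a.e. point has trivial stabilizer. -/
def PMPAction.IsFree {G X : Type} [Group G] [MeasurableSpace X] {μ : Measure X}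
    (α : PMPAction G X μ) : Prop :=
  ∀ᵐ x ∂μ, ∀ g : G, α.act g x = x → g = 1

/-- `R` is the orbit equivalence relation of the action `α` restricted to the subgroup `H`. -/
def IsOrbitRel {G X : Type} [Group G] [MeasurableSpace X] {μ : Measure X}
    (α : PMPAction G X μ) (H : Subgroup G) (R : CBER X) : Prop :=
  R.dom = Set.univ ∧ ∀ x y, (R.rel x y ↔ ∃ g ∈ H, α.act g x = y)

/-- A countable group is measurably freely indecomposable (MFI) if the orbit equivalence
relation of every free p.m.p. action of it on a standard probability space is freely
indecomposable. -/
def MFI (G : Type) [Group G] [Countable G] : Prop :=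
  ∀ (X : Type) [MeasurableSpace X] [StandardBorelSpace X]
    (μ : Measure X) [IsProbabilityMeasure μ]
    (α : PMPAction G X μ) (R : CBER X),
    α.IsFree → IsOrbitRel α ⊤ R → FreelyIndecomposableMod μ R

/-- `G` is the internal free product of the family of subgroups `H`. -/
def IsFreeProductOf (G : Type) [Group G] {ι : Type} (H : ι → Subgroup G) : Prop :=
  Function.Bijective (Monoid.CoprodI.lift fun i => (H i).subtype)

/-- A Borel fundamental domain for an action, of the coupling kind: meets a.e. orbit,
and meets each orbit at most once mod null. -/
def IsFundamentalDomainFor {G : Type} [Group G] {Ω : Type} [MeasurableSpace Ω]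
    (ν : Measure Ω) (a : G → Ω → Ω) (D : Set Ω) : Prop :=
  MeasurableSet D ∧ (∀ᵐ x ∂ν, ∃ g : G, a g x ∈ D) ∧
    ∀ g : G, g ≠ 1 → ν (D ∩ a g ⁻¹' D) = 0

/-- A measure equivalence coupling between `G` and `H`: a standard σ-finite measure space
with commuting measure-preserving essentially free actions of `G` and `H`, each admitting
a Borel fundamental domain of finite positive measure. -/
structure MECoupling (G : Type) [Group G] (H : Type) [Group H] where
  (Ω : Type)
  [mΩ : MeasurableSpace Ω]
  [sbΩ : StandardBorelSpace Ω]
  (ν : Measure Ω)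
  sigmaFinite : SigmaFinite ν
  aG : G → Ω → Ω
  aH : H → Ω → Ω
  DG : Set Ω
  DH : Set Ω
  aG_one : ∀ x, aG 1 x = x
  aG_mul : ∀ g g' x, aG (g * g') x = aG g (aG g' x)
  aH_one : ∀ x, aH 1 x = x
  aH_mul : ∀ h h' x, aH (h * h') x = aH h (aH h' x)
  comm : ∀ g h x, aG g (aH h x) = aH h (aG g x)
  mp_aG : ∀ g, MeasurePreserving (aG g) ν ν
  mp_aH : ∀ h, MeasurePreserving (aH h) ν ν
  free_aG : ∀ᵐ x ∂ν, ∀ g, aG g x = x → g = 1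
  free_aH : ∀ᵐ x ∂ν, ∀ h, aH h x = x → h = 1
  fund_DG : IsFundamentalDomainFor ν aG DG
  fund_DH : IsFundamentalDomainFor ν aH DH
  DG_pos : 0 < ν DG
  DG_fin : ν DG < ⊤
  DH_pos : 0 < ν DH
  DH_fin : ν DH < ⊤

/-- The generalized index (compression constant) of a measure equivalence coupling. -/
noncomputable def MECoupling.index {G : Type} [Group G] {H : Type} [Group H]
    (c : MECoupling G H) : ENNReal :=
  c.ν c.DH / c.ν c.DG

/-- Measure equivalence of countable groups. -/
def MeasureEquivalent (G : Type) [Group G] (H : Type) [Group H] : Prop :=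
  Nonempty (MECoupling G H)

/-- Measure equivalence with a prescribed generalized index. -/
def MEwithIndex (G : Type) [Group G] (H : Type) [Group H] (κ : ENNReal) : Prop :=
  ∃ c : MECoupling G H, c.index = κ

section LusinNovikov

open Set Filter Topology

/-- `J` is a countable union of Borel sets on each of which `f` is injective. -/
def IsSigmaInj {Z Y : Type*} [MeasurableSpace Z] (f : Z → Y) (J : Set Z) : Prop :=
  ∃ 𝓑 : Set (Set Z), 𝓑.Countable ∧ (∀ B ∈ 𝓑, MeasurableSet B ∧ InjOn f B) ∧ J = ⋃₀ 𝓑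

namespace IsSigmaInj

variable {Z Y : Type*} [MeasurableSpace Z] {f : Z → Y}

theorem measurableSet {J : Set Z} (hJ : IsSigmaInj f J) : MeasurableSet J := by
  obtain ⟨𝓑, hc, hB, rfl⟩ := hJ
  exact MeasurableSet.sUnion hc fun B h => (hB B h).1

theorem of_injOn {B : Set Z} (hB : MeasurableSet B) (hf : InjOn f B) : IsSigmaInj f B :=
  ⟨{B}, countable_singleton B, by rintro _ rfl; exact ⟨hB, hf⟩, by simp⟩

theorem iUnion {κ : Type*} [Countable κ] {J : κ → Set Z} (hJ : ∀ k, IsSigmaInj f (J k)) :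
    IsSigmaInj f (⋃ k, J k) := by
  choose 𝓑 hc hB hJ using hJ
  refine ⟨⋃ k, 𝓑 k, countable_iUnion hc, ?_, ?_⟩
  · intro B h
    obtain ⟨k, hk⟩ := mem_iUnion.1 h
    exact hB k B hk
  · rw [sUnion_iUnion]
    exact iUnion_congr hJ

theorem union {J K : Set Z} (hJ : IsSigmaInj f J) (hK : IsSigmaInj f K) :
    IsSigmaInj f (J ∪ K) := by
  rw [union_eq_iUnion]
  exact iUnion (by rintro (_ | _) <;> assumption)

end IsSigmaInj

/-- Finitely many analytic sets whose intersection with an analytic set `B` is empty can be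
enlarged to Borel sets with the same property. -/
theorem exists_measurable_superset_inter_eq_empty {Y ι : Type*} [TopologicalSpace Y] [PolishSpace Y]
    [MeasurableSpace Y] [BorelSpace Y] (C : ι → Set Y) (hC : ∀ i, AnalyticSet (C i))
    (s : Finset ι) : ∀ B : Set Y, AnalyticSet B → (∀ y ∈ B, ¬ ∀ i ∈ s, y ∈ C i) →
      ∃ D : ι → Set Y, (∀ i, MeasurableSet (D i)) ∧ (∀ i, C i ⊆ D i) ∧
        ∀ y ∈ B, ¬ ∀ i ∈ s, y ∈ D i := by
  classical
  induction s using Finset.induction_on with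
  | empty =>
    intro B _ h
    exact ⟨fun _ => univ, fun _ => MeasurableSet.univ, fun _ => subset_univ _,
      fun y hy _ => h y hy (by simp)⟩
  | insert a s ha ih =>
    intro B hB h
    have hinter : AnalyticSet (⋂ o : Option s, o.elim B fun i => C i) :=
      AnalyticSet.iInter (by rintro (_ | i); exacts [hB, hC i])
    have hdisj : Disjoint (C a) (⋂ o : Option s, o.elim B fun i => C i) := by
      refine Set.disjoint_left.2 fun y hy hy' => ?_
      rw [mem_iInter] at hy'
      refine h y (hy' none) fun i hi => ?_
      rcases Finset.mem_insert.1 hi with rfl | hi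
      · exact hy
      · exact hy' (some ⟨i, hi⟩)
    obtain ⟨E, hCE, hE, hEm⟩ := (hC a).measurablySeparable hinter hdisj
    have hBE : AnalyticSet (B ∩ E) := by
      rw [inter_eq_iInter]
      exact AnalyticSet.iInter (by rintro (_ | _); exacts [hEm.analyticSet, hB])
    obtain ⟨D, hDm, hCD, hD⟩ := ih (B ∩ E) hBE (by
      rintro y ⟨hyB, hyE⟩ hy
      refine Set.disjoint_left.1 hE (mem_iInter.2 ?_) hyE
      rintro (_ | i)
      exacts [hyB, hy i i.2])
    refine ⟨Function.update D a E, fun i => ?_, fun i => ?_, fun y hy hall => ?_⟩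
    · rcases eq_or_ne i a with rfl | hi
      · simpa using hEm
      · simpa [hi] using hDm i
    · rcases eq_or_ne i a with rfl | hi
      · simpa using hCE
      · simpa [hi] using hCD i
    · have hyE : y ∈ E := by simpa using hall a (Finset.mem_insert_self a s)
      refine hD y ⟨hy, hyE⟩ fun i hi => ?_
      have hia : i ≠ a := fun h => ha (h ▸ hi)
      simpa [hia] using hall i (Finset.mem_insert_of_mem hi)

/-- In a separable metric space, distinct points are separated by one of countably many disjoint
pairs of closed sets of small diameter. -/
theorem exists_countable_separating_pairs (Z : Type*) [MetricSpace Z] [SecondCountableTopology Z]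
    {ε : ℝ} (hε : 0 < ε) :
    ∃ (κ : Type) (_ : Countable κ) (U : κ → Bool → Set Z),
      (∀ k b, IsClosed (U k b)) ∧ (∀ k b, Metric.ediam (U k b) ≤ ENNReal.ofReal ε) ∧
      (∀ k, Disjoint (U k true) (U k false)) ∧
      ∀ z z' : Z, z ≠ z' → ∃ k, z ∈ U k true ∧ z' ∈ U k false := by
  rcases isEmpty_or_nonempty Z with hZ | hZ
  · exact ⟨Empty, inferInstance, fun _ _ => ∅, by simp, by simp, by simp, fun z => hZ.elim z⟩
  let q := TopologicalSpace.denseSeq Z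
  let W : ℕ × ℕ × ℕ → Bool → Set Z := fun k b =>
    Metric.closedBall (q (bif b then k.1 else k.2.1)) (1 / (k.2.2 + 1 : ℝ))
  refine ⟨{k : ℕ × ℕ × ℕ // 2 * (1 / (k.2.2 + 1 : ℝ)) ≤ ε ∧ Disjoint (W k true) (W k false)},
    inferInstance, fun k => W k, fun k b => Metric.isClosed_closedBall, fun k b => ?_,
    fun k => k.2.2, fun z z' hzz' => ?_⟩
  · refine Metric.ediam_le_of_forall_dist_le fun x hx y hy => ?_
    have h1 := Metric.mem_closedBall.1 hx
    have h2 := Metric.mem_closedBall.1 hy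
    have h3 := dist_triangle_right x y (q (bif b then k.1.1 else k.1.2.1))
    linarith [k.2.1]
  · have hd : 0 < dist z z' := dist_pos.2 hzz'
    obtain ⟨n, hn⟩ := exists_nat_one_div_lt (show 0 < min (ε / 2) (dist z z' / 4) by positivity)
    have hn1 := hn.trans_le (min_le_left _ _)
    have hn2 := hn.trans_le (min_le_right _ _)
    have hr : (0 : ℝ) < 1 / (n + 1 : ℝ) := by positivity
    obtain ⟨m, hm⟩ := (TopologicalSpace.denseRange_denseSeq Z).exists_dist_lt z hr
    obtain ⟨m', hm'⟩ := (TopologicalSpace.denseRange_denseSeq Z).exists_dist_lt z' hr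
    refine ⟨⟨(m, m', n), by dsimp only; linarith, Set.disjoint_left.2 fun w hw hw' => ?_⟩,
      Metric.mem_closedBall.2 hm.le, Metric.mem_closedBall.2 hm'.le⟩
    have h1 : dist w (q m) ≤ 1 / (n + 1 : ℝ) := Metric.mem_closedBall.1 hw
    have h2 : dist w (q m') ≤ 1 / (n + 1 : ℝ) := Metric.mem_closedBall.1 hw'
    have h3 : dist z (q m) < 1 / (n + 1 : ℝ) := hm
    have h4 : dist z' (q m') < 1 / (n + 1 : ℝ) := hm'
    have h5 := dist_triangle4 z (q m) w z'
    have h6 := dist_triangle_right w z' (q m')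
    rw [dist_comm (q m) w] at h5
    linarith

/-- A family of sets is `f`-big if, off every set which is a countable union of Borel sets where
`f` is injective, all members of the family meet a common fibre of `f`. -/
def IsBigFamily {Z Y ι : Type*} [MeasurableSpace Z] (f : Z → Y) (A : ι → Set Z) : Prop :=
  ∀ J, IsSigmaInj f J → ∃ y, ∀ i, ∃ z ∈ A i \ J, f z = y

/-- Every member of a finite big family of closed sets can be split into two disjoint closed
sets of small diameter while keeping the family big. -/
theorem IsBigFamily.exists_split {Z Y ι : Type*} [MetricSpace Z] [CompleteSpace Z]
    [SecondCountableTopology Z] [MeasurableSpace Z] [BorelSpace Z] [TopologicalSpace Y]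
    [PolishSpace Y] [MeasurableSpace Y] [BorelSpace Y] [Finite ι] {f : Z → Y} (hf : Continuous f)
    {A : ι → Set Z} (hA : ∀ i, IsClosed (A i)) (hbig : IsBigFamily f A) {ε : ℝ} (hε : 0 < ε) :
    ∃ A' : ι × Bool → Set Z, (∀ p, IsClosed (A' p)) ∧ (∀ p, A' p ⊆ A p.1) ∧
      (∀ p, Metric.ediam (A' p) ≤ ENNReal.ofReal ε) ∧
      (∀ i, Disjoint (A' (i, true)) (A' (i, false))) ∧ IsBigFamily f A' := by
  obtain ⟨κ, _, U, hUc, hUd, hUdisj, hUsep⟩ := exists_countable_separating_pairs Z hε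
  by_contra hcon
  have hsmall : ∀ c : ι → κ, ∃ J, IsSigmaInj f J ∧
      ¬ ∃ y, ∀ p : ι × Bool, ∃ z ∈ (A p.1 ∩ U (c p.1) p.2) \ J, f z = y := by
    intro c
    by_contra! hc
    refine hcon ⟨fun p => A p.1 ∩ U (c p.1) p.2, fun p => (hA _).inter (hUc _ _),
      fun p => inter_subset_left, fun p => (Metric.ediam_mono inter_subset_right).trans (hUd _ _),
      fun i => (hUdisj _).mono inter_subset_right inter_subset_right, hc⟩
  choose J hJ hJs using hsmall
  have hK : IsSigmaInj f (⋃ c, J c) := IsSigmaInj.iUnion hJ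
  set K := ⋃ c, J c
  have hAK : ∀ i, MeasurableSet (A i \ K) := fun i => (hA i).measurableSet.diff hK.measurableSet
  let P : ι → Set (Z × Z) := fun i =>
    {p | p.1 ∈ A i \ K ∧ p.2 ∈ A i \ K ∧ p.1 ≠ p.2 ∧ f p.1 = f p.2}
  have hPm : ∀ i, MeasurableSet (P i) := fun i =>
    (measurable_fst (hAK i)).inter ((measurable_snd (hAK i)).inter
      ((measurableSet_eq_fun measurable_fst measurable_snd).compl.inter
        (measurableSet_eq_fun (hf.measurable.comp measurable_fst)
          (hf.measurable.comp measurable_snd))))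
  have hCan : ∀ i, AnalyticSet ((fun p : Z × Z => f p.1) '' P i) := fun i =>
    (hPm i).analyticSet_image (hf.measurable.comp measurable_fst)
  have _ := Fintype.ofFinite ι
  obtain ⟨D, hDm, hCD, hD⟩ := exists_measurable_superset_inter_eq_empty _ hCan Finset.univ univ
    MeasurableSet.univ.analyticSet (by
      intro y _ hy
      choose p hp hpy using fun i => hy i (Finset.mem_univ i)
      choose c hc using fun i => hUsep _ _ (hp i).2.2.1
      refine hJs c ⟨y, ?_⟩
      have hsub : J c ⊆ K := subset_iUnion J c
      rintro ⟨i, _ | _⟩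
      · exact ⟨(p i).2, ⟨⟨(hp i).2.1.1, (hc i).2⟩, fun h => (hp i).2.1.2 (hsub h)⟩,
          (hp i).2.2.2.symm.trans (hpy i)⟩
      · exact ⟨(p i).1, ⟨⟨(hp i).1.1, (hc i).1⟩, fun h => (hp i).1.2 (hsub h)⟩, hpy i⟩)
  have hL : ∀ i, IsSigmaInj f ((A i \ K) \ f ⁻¹' D i) := fun i =>
    IsSigmaInj.of_injOn ((hAK i).diff (hf.measurable (hDm i))) (by
      intro z hz z' hz' hzz'
      by_contra hne
      exact hz.2 (hCD i ⟨(z, z'), ⟨hz.1, hz'.1, hne, hzz'⟩, rfl⟩))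
  obtain ⟨y, hy⟩ := hbig _ (hK.union (IsSigmaInj.iUnion hL))
  refine hD y (mem_univ y) fun i _ => ?_
  obtain ⟨z, ⟨hzA, hzn⟩, rfl⟩ := hy i
  by_contra hzD
  exact hzn (Or.inr (mem_iUnion.2 ⟨i, ⟨hzA, fun h => hzn (Or.inl h)⟩, hzD⟩))

/-- The Lusin–Novikov theorem for continuous maps. -/
theorem isSigmaInj_univ_of_continuous {Z Y : Type*} [MetricSpace Z] [CompleteSpace Z]
    [SecondCountableTopology Z] [MeasurableSpace Z] [BorelSpace Z] [TopologicalSpace Y]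
    [PolishSpace Y] [MeasurableSpace Y] [BorelSpace Y] {f : Z → Y} (hf : Continuous f)
    (hcount : ∀ y, (f ⁻¹' {y}).Countable) : IsSigmaInj f univ := by
  by_contra hbig
  let Good : ℕ → (List Bool → Set Z) → Prop := fun n A =>
    (∀ l, IsClosed (A l)) ∧ IsBigFamily f fun l : {l : List Bool // l.length = n} => A l
  have hzero : Good 0 fun _ => univ := by
    refine ⟨fun _ => isClosed_univ, fun J hJ => ?_⟩
    obtain ⟨z, hz⟩ : ∃ z, z ∉ J := by
      by_contra! h
      exact hbig (eq_univ_of_forall h ▸ hJ)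
    exact ⟨f z, fun _ => ⟨z, ⟨mem_univ z, hz⟩, rfl⟩⟩
  have hstep : ∀ n A, Good n A → ∃ A', Good (n + 1) A' ∧
      ∀ l : List Bool, l.length = n → (∀ b, A' (b :: l) ⊆ A l ∧
        Metric.ediam (A' (b :: l)) ≤ ENNReal.ofReal (1 / (n + 1 : ℝ))) ∧
        Disjoint (A' (true :: l)) (A' (false :: l)) := by
    rintro n A ⟨hcl, hA⟩
    have : Finite {l : List Bool // l.length = n} := List.finite_length_eq Bool n
    obtain ⟨A', hcl', hsub, hdiam, hdisj, hA'⟩ :=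
      hA.exists_split (A := fun l : {l : List Bool // l.length = n} => A l) hf (fun l => hcl l)
        (show (0 : ℝ) < 1 / (n + 1) by positivity)
    let B : List Bool → Set Z
      | [] => univ
      | b :: l => if h : l.length = n then A' (⟨l, h⟩, b) else univ
    have hB : ∀ b l (h : l.length = n), B (b :: l) = A' (⟨l, h⟩, b) := fun b l h => dif_pos h
    refine ⟨B, ⟨?_, fun J hJ => ?_⟩, fun l hl => ⟨fun b => ?_, ?_⟩⟩
    · rintro (_ | ⟨b, l⟩)
      · exact isClosed_univ
      · by_cases h : l.length = n
        · rw [hB b l h]; exact hcl' _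
        · simp [B, h]
    · obtain ⟨y, hy⟩ := hA' J hJ
      refine ⟨y, ?_⟩
      rintro ⟨_ | ⟨b, l⟩, hl⟩
      · simp at hl
      · have hl' : l.length = n := by simpa using hl
        simpa only [hB b l hl'] using hy (⟨l, hl'⟩, b)
    · rw [hB b l hl]
      exact ⟨hsub _, hdiam _⟩
    · rw [hB _ l hl, hB _ l hl]
      exact hdisj _
  choose! next hnext hnext' using hstep
  let 𝓐 : ℕ → List Bool → Set Z := fun n => Nat.rec (fun _ => univ) next n
  have hgood : ∀ n, Good n (𝓐 n) := by
    intro n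
    induction n with
    | zero => exact hzero
    | succ n ih => exact hnext n _ ih
  let S : List Bool → Set Z := fun l => 𝓐 l.length l
  have hS : ∀ b l, S (b :: l) ⊆ S l ∧
      Metric.ediam (S (b :: l)) ≤ ENNReal.ofReal (1 / (l.length + 1 : ℝ)) := fun b l =>
    (hnext' l.length _ (hgood l.length) l rfl).1 b
  have hSdisj : CantorScheme.Disjoint S := by
    intro l
    have h : Disjoint (S (true :: l)) (S (false :: l)) :=
      (hnext' l.length _ (hgood l.length) l rfl).2
    rintro (_ | _) (_ | _) hne
    exacts [(hne rfl).elim, h.symm, h, (hne rfl).elim]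
  have hSanti : CantorScheme.ClosureAntitone S :=
    CantorScheme.Antitone.closureAntitone (fun l b => (hS b l).1) fun l => (hgood _).1 l
  choose y hy using fun n => (hgood n).2 ∅ ⟨∅, countable_empty, by simp, by simp⟩
  choose w hw using hy
  have hdiam : CantorScheme.VanishingDiam S := by
    intro x
    rw [← tendsto_add_atTop_iff_nat 1]
    refine tendsto_of_tendsto_of_tendsto_of_le_of_le tendsto_const_nhds ?_ (fun _ => zero_le)
      (fun n => ?_) (g := fun _ => 0) (h := fun n : ℕ => ENNReal.ofReal (1 / (n + 1 : ℝ)))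
    · simpa using ENNReal.tendsto_ofReal tendsto_one_div_add_atTop_nhds_zero_nat
    · simpa using (hS (x n) (PiNat.res x n)).2
  have htotal : (CantorScheme.inducedMap S).1 = univ :=
    hSanti.map_of_vanishingDiam hdiam fun l =>
      ⟨w l.length ⟨l, rfl⟩, (hw l.length ⟨l, rfl⟩).1.1⟩
  let g : (ℕ → Bool) → Z := fun x => (CantorScheme.inducedMap S).2 ⟨x, htotal ▸ mem_univ x⟩
  have hginj : Function.Injective g := fun x x' h =>
    congrArg Subtype.val (hSdisj.map_injective h)
  have hlim : ∀ x, Tendsto y atTop (𝓝 (f (g x))) := by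
    intro x
    have hanti : ∀ m n, m ≤ n → S (PiNat.res x n) ⊆ S (PiNat.res x m) := by
      intro m n hmn
      induction n, hmn using Nat.le_induction with
      | base => exact subset_rfl
      | succ n _ ih => exact (hS (x n) (PiNat.res x n)).1.trans ih
    have hwmem : ∀ n, w n ⟨PiNat.res x n, PiNat.res_length x n⟩ ∈ S (PiNat.res x n) := by
      intro n
      have h := (hw n ⟨PiNat.res x n, PiNat.res_length x n⟩).1.1
      simpa only [S, PiNat.res_length] using h
    have hwlim : Tendsto (fun n => w n ⟨PiNat.res x n, PiNat.res_length x n⟩) atTop (𝓝 (g x)) := by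
      rw [Metric.tendsto_atTop]
      intro ε hε
      obtain ⟨N, hN⟩ := hdiam.dist_lt ε hε x
      exact ⟨N, fun n hn => hN _ (hanti N n hn (hwmem n)) _ (CantorScheme.map_mem _ N)⟩
    exact ((hf.tendsto _).comp hwlim).congr fun n => (hw n _).2
  have hconst : ∀ x, g x ∈ f ⁻¹' {f (g fun _ => true)} := fun x =>
    tendsto_nhds_unique (hlim x) (hlim _)
  have huniv : (univ : Set (ℕ → Bool)).Countable :=
    ((hcount _).preimage_of_injOn hginj.injOn).mono fun x _ => hconst x
  have hcard := Cardinal.mk_le_aleph0_iff.2 (countable_univ_iff.1 huniv)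
  rw [Cardinal.mk_arrow] at hcard
  simp only [Cardinal.mk_bool, Cardinal.mk_nat, Cardinal.lift_aleph0, Cardinal.lift_ofNat] at hcard
  exact (Cardinal.cantor _).not_ge hcard

/-- The Lusin–Novikov theorem: a countable-to-one Borel map between standard Borel spaces is
injective on each piece of some countable Borel cover. -/
theorem isSigmaInj_univ {Z Y : Type*} [MeasurableSpace Z] [StandardBorelSpace Z]
    [MeasurableSpace Y] [StandardBorelSpace Y] {f : Z → Y} (hf : Measurable f)
    (hcount : ∀ y, (f ⁻¹' {y}).Countable) : IsSigmaInj f univ := by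
  let τ := upgradeStandardBorel Z
  let := upgradeStandardBorel Y
  obtain ⟨t, hle, hcont, hpol⟩ := hf.exists_continuous
  have hborel : @BorelSpace Z t _ := @BorelSpace.mk Z t _
    ((eq_borel_upgradeStandardBorel Z).trans
      (borel_eq_borel_of_le hpol τ.toPolishSpace hle).symm)
  clear_value τ
  clear hle τ
  let := TopologicalSpace.upgradeIsCompletelyMetrizable Z
  exact isSigmaInj_univ_of_continuous hcont hcount

end LusinNovikov

section InvariantMap

open Set

/-- A CBER is smooth as soon as it has a countable-to-one Borel invariant map. -/
theorem CBER.Smooth.of_invariant {X Y : Type} [MeasurableSpace X] [StandardBorelSpace X]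
    [MeasurableSpace Y] [StandardBorelSpace Y] (S : CBER X) {p : X → Y} (hp : Measurable p)
    (hcount : ∀ y, (p ⁻¹' {y}).Countable) (hinv : ∀ x x', S.rel x x' → p x = p x') :
    S.Smooth := by
  obtain ⟨𝓑, h𝓑c, h𝓑, hcover⟩ := isSigmaInj_univ hp hcount
  obtain ⟨B, hB⟩ := h𝓑c.insert ∅ |>.exists_eq_range (insert_nonempty _ _)
  have hBmem : ∀ n, MeasurableSet (B n) ∧ InjOn p (B n) := by
    intro n
    have hn : B n ∈ insert ∅ 𝓑 := hB ▸ mem_range_self n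
    rcases hn with hn | hn
    · rw [hn]; exact ⟨MeasurableSet.empty, injOn_empty p⟩
    · exact h𝓑 _ hn
  have hBcover : ∀ x, ∃ n, x ∈ B n := by
    intro x
    have hx : x ∈ ⋃₀ 𝓑 := hcover ▸ mem_univ x
    obtain ⟨A, hA, hxA⟩ := hx
    have hA' : A ∈ range B := hB ▸ mem_insert_of_mem ∅ hA
    obtain ⟨n, rfl⟩ := hA'
    exact ⟨n, hxA⟩
  let T : ℕ → Set X := fun n => {x | ∃ y ∈ B n, S.rel x y}
  have hTm : ∀ n, MeasurableSet (T n) := by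
    intro n
    have himg : T n = Prod.fst '' ({q : X × X | S.rel q.1 q.2} ∩ Prod.snd ⁻¹' B n) := by
      ext x
      constructor
      · rintro ⟨y, hy, hxy⟩
        exact ⟨(x, y), ⟨hxy, hy⟩, rfl⟩
      · rintro ⟨⟨x, y⟩, ⟨hxy, hy⟩, rfl⟩
        exact ⟨y, hy, hxy⟩
    rw [himg]
    refine (S.rel_meas.inter (measurable_snd (hBmem n).1)).image_of_measurable_injOn
      measurable_fst ?_
    rintro ⟨x, y⟩ ⟨hxy, hy⟩ ⟨x', y'⟩ ⟨hxy', hy'⟩ (rfl : x = x')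
    have hpy : p y = p y' := hinv _ _ (S.trans (S.symm hxy) hxy')
    exact Prod.ext rfl ((hBmem n).2 hy hy' hpy)
  have hTinv : ∀ n x x', S.rel x x' → x ∈ T n → x' ∈ T n := by
    rintro n x x' hxx' ⟨y, hy, hxy⟩
    exact ⟨y, hy, S.trans (S.symm hxx') hxy⟩
  refine ⟨S.dom ∩ ⋃ n, (B n ∩ ⋂ m, ⋂ (_ : m < n), (T m)ᶜ), S.dom_meas.inter
    (MeasurableSet.iUnion fun n => (hBmem n).1.inter (MeasurableSet.iInter fun m =>
      MeasurableSet.iInter fun _ => (hTm m).compl)), inter_subset_left, fun x hx => ?_⟩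
  classical
  have hex : ∃ n, x ∈ T n := by
    obtain ⟨n, hn⟩ := hBcover x
    exact ⟨n, x, hn, S.refl x hx⟩
  obtain ⟨y, hy, hxy⟩ := Nat.find_spec hex
  refine ⟨y, ⟨⟨(S.rel_dom hxy).2, mem_iUnion.2 ⟨Nat.find hex, hy, ?_⟩⟩, hxy⟩, ?_⟩
  · simp only [mem_iInter, mem_compl_iff]
    exact fun m hm hym => Nat.find_min hex hm (hTinv m y x (S.symm hxy) hym)
  · rintro y' ⟨⟨_, hy'⟩, hxy'⟩
    obtain ⟨n, hyn, hmin⟩ := mem_iUnion.1 hy'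
    simp only [mem_iInter, mem_compl_iff] at hmin
    have hn : n = Nat.find hex := by
      refine ((Nat.find_eq_iff hex).2 ⟨⟨y', hyn, hxy'⟩, fun m hm hxm => ?_⟩).symm
      exact hmin m hm (hTinv m x y' hxy' hxm)
    subst hn
    exact (hBmem _).2 hyn hy (hinv _ _ (S.trans (S.symm hxy') hxy))

/-- Smoothness is preserved by inner conjugacy. -/
theorem CBER.Smooth.of_innerConjugate {X : Type} [MeasurableSpace X] {R S₁ S₂ : CBER X}
    (hconj : InnerConjugate R S₁ S₂) (hS : S₂.Smooth) : S₁.Smooth := by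
  obtain ⟨φ, -, hsrc, htgt, hφ⟩ := hconj
  obtain ⟨D, hDm, hDsub, hD⟩ := hS
  rw [← hsrc] at hDsub hD
  rw [CBER.Smooth, ← htgt]
  refine ⟨φ.tgt ∩ φ.invFun ⁻¹' D, φ.tgt_meas.inter (φ.meas_invFun hDm), inter_subset_left,
    fun x hx => ?_⟩
  obtain ⟨y, ⟨hyD, hxy⟩, huniq⟩ := hD _ (φ.mapsTo_inv hx)
  have hy := hDsub hyD
  refine ⟨φ.toFun y, ⟨⟨φ.mapsTo hy, ?_⟩, ?_⟩, ?_⟩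
  · simpa [φ.left_inv y hy] using hyD
  · have h := (hφ _ (φ.mapsTo_inv hx) _ hy).1 hxy
    rwa [φ.right_inv x hx] at h
  · rintro z ⟨⟨hz, hzD⟩, hxz⟩
    have h := huniq (φ.invFun z) ⟨hzD, (hφ _ (φ.mapsTo_inv hx) _ (φ.mapsTo_inv hz)).2 (by
      rwa [φ.right_inv x hx, φ.right_inv z hz])⟩
    rw [← h, φ.right_inv z hz]

end InvariantMap

section ReducedPath

open Set

variable {X : Type} [MeasurableSpace X] {ι : Type}

/-- `y 0, …, y n` is a path whose `j`-th step lies in `Rf (i j)`. -/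
def IsFactorPath (Rf : ι → CBER X) (n : ℕ) (y : ℕ → X) (i : ℕ → ι) : Prop :=
  ∀ j < n, (Rf (i j)).rel (y j) (y (j + 1))

/-- A path without trivial steps or consecutive steps in the same factor, which neither starts
with a step in `Rf b` nor ends with a step in `Rf a`. -/
structure IsReducedPath (Rf : ι → CBER X) (b a : ι) (n : ℕ) (y : ℕ → X) (i : ℕ → ι) : Prop where
  path : IsFactorPath Rf n y i
  step_ne : ∀ j < n, y j ≠ y (j + 1)
  index_ne : ∀ j, j + 1 < n → i j ≠ i (j + 1)
  first_ne : 0 < n → i 0 ≠ b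
  last_ne : 0 < n → i (n - 1) ≠ a

/-- Related points are joined by a path of factor steps. -/
theorem exists_isFactorPath_of_eqvGen (Rf : ι → CBER X) [Nonempty ι] {x z : X}
    (h : Relation.EqvGen (fun u v => ∃ i, (Rf i).rel u v) x z) :
    ∃ n y i, IsFactorPath Rf n y i ∧ y 0 = x ∧ y n = z := by
  have hrt : Relation.ReflTransGen (fun u v => ∃ i, (Rf i).rel u v) x z := by
    induction h with
    | rel _ _ h => exact .single h
    | refl _ => exact .refl
    | symm _ _ _ ih =>
      have : Std.Symm fun u v => ∃ i, (Rf i).rel u v :=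
        ⟨fun _ _ ⟨i, hi⟩ => ⟨i, (Rf i).symm hi⟩⟩
      exact Relation.ReflTransGen.stdSymm.symm _ _ ih
    | trans _ _ _ _ _ ih ih' => exact ih.trans ih'
  clear h
  induction hrt using Relation.ReflTransGen.head_induction_on with
  | refl => exact ⟨0, fun _ => z, fun _ => Classical.arbitrary ι, by simp [IsFactorPath], rfl, rfl⟩
  | @head u _ hstep _ ih =>
    obtain ⟨k, hk⟩ := hstep
    obtain ⟨n, y, i, hpath, hy0, hyn⟩ := ih
    refine ⟨n + 1, fun j => Nat.casesOn j u y, fun j => Nat.casesOn j k i, ?_, rfl, hyn⟩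
    rintro (_ | j) hj
    · simpa [hy0] using hk
    · exact hpath j (by omega)

/-- A shortest path from the `Rf b`-class of `x` to the `Rf a`-class of `z` is reduced. -/
theorem exists_isReducedPath (Rf : ι → CBER X) {b a : ι} {x z : X} (hx : x ∈ (Rf b).dom)
    (hz : z ∈ (Rf a).dom) (h : Relation.EqvGen (fun u v => ∃ i, (Rf i).rel u v) x z) :
    ∃ n y i, IsReducedPath Rf b a n y i ∧ (Rf b).rel x (y 0) ∧ (Rf a).rel (y n) z := by
  classical
  have : Nonempty ι := ⟨a⟩
  have hex : ∃ n y i, IsFactorPath Rf n y i ∧ (Rf b).rel x (y 0) ∧ (Rf a).rel (y n) z := by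
    obtain ⟨n, y, i, hpath, rfl, rfl⟩ := exists_isFactorPath_of_eqvGen Rf h
    exact ⟨n, y, i, hpath, (Rf b).refl _ hx, (Rf a).refl _ hz⟩
  obtain ⟨y, i, hpath, hxy, hyz⟩ := Nat.find_spec hex
  have hmin := fun m => Nat.find_min (H := hex) (m := m)
  generalize Nat.find hex = n at *
  refine ⟨n, y, i, ⟨hpath, fun j hj heq => ?_, fun j hj heq => ?_, fun hn heq => ?_,
    fun hn heq => ?_⟩, hxy, hyz⟩
  · refine hmin (n - 1) (by omega) ⟨fun k => if k ≤ j then y k else y (k + 1),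
      fun k => if k < j then i k else i (k + 1), fun k hk => ?_, by simpa using hxy, ?_⟩
    · rcases lt_trichotomy k j with hkj | rfl | hkj
      · simpa [hkj, hkj.le, Nat.succ_le_of_lt hkj] using hpath k (by omega)
      · simpa [heq] using hpath (k + 1) (by omega)
      · simpa [hkj.not_ge, hkj.not_gt, show ¬ k + 1 ≤ j by omega] using hpath (k + 1) (by omega)
    · dsimp only
      split_ifs with hnj
      · obtain rfl : n = j + 1 := by omega
        rwa [Nat.add_sub_cancel, heq]
      · rwa [show n - 1 + 1 = n by omega]
  · refine hmin (n - 1) (by omega) ⟨fun k => if k ≤ j then y k else y (k + 1),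
      fun k => if k ≤ j then i k else i (k + 1), fun k hk => ?_, by simpa using hxy, ?_⟩
    · rcases lt_trichotomy k j with hkj | rfl | hkj
      · simpa [hkj, hkj.le, Nat.succ_le_of_lt hkj] using hpath k (by omega)
      · have h1 := hpath k (by omega)
        have h2 := hpath (k + 1) (by omega)
        rw [← heq] at h2
        simpa using (Rf _).trans h1 h2
      · simpa [hkj.not_ge, show ¬ k + 1 ≤ j by omega] using hpath (k + 1) (by omega)
    · dsimp only
      rwa [if_neg (by omega), show n - 1 + 1 = n by omega]
  · refine hmin (n - 1) (by omega) ⟨fun k => y (k + 1), fun k => i (k + 1),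
      fun k hk => hpath (k + 1) (by omega), ?_, ?_⟩
    · exact (Rf b).trans hxy (heq ▸ hpath 0 hn)
    · simpa only [show n - 1 + 1 = n by omega] using hyz
  · refine hmin (n - 1) (by omega) ⟨y, i, fun k hk => hpath k (by omega), hxy, ?_⟩
    have h1 := hpath (n - 1) (by omega)
    rw [heq, show n - 1 + 1 = n by omega] at h1
    exact (Rf a).trans h1 hyz

/-- In a freely independent family, reduced paths joining the same two classes of distinct
factors start at the same point. -/
theorem FreelyIndep.start_eq {Rf : ι → CBER X} (hfree : FreelyIndep Rf) {b a : ι} (hab : b ≠ a)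
    {n n' : ℕ} {y y' : ℕ → X} {i i' : ℕ → ι} (h : IsReducedPath Rf b a n y i)
    (h' : IsReducedPath Rf b a n' y' i') (hstart : (Rf b).rel (y 0) (y' 0))
    (hend : (Rf a).rel (y n) (y' n')) : y 0 = y' 0 := by
  classical
  by_contra hne
  let c : ℕ → X := fun j =>
    if j ≤ n then y (n - j) else if j ≤ n + 1 + n' then y' (j - (n + 1)) else y n
  let k : ℕ → ι := fun j =>
    if j < n then i (n - 1 - j) else if j = n then b else
      if j < n + 1 + n' then i' (j - (n + 1)) else a
  let N := if y n = y' n' then n + 1 + n' else n + 1 + n' + 1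
  have hN : N ≤ n + 1 + n' + 1 := by dsimp only [N]; split_ifs <;> omega
  have hNeq : N = n + 1 + n' + 1 → y n ≠ y' n' := by
    dsimp only [N]; split_ifs with hc
    · omega
    · exact fun _ => hc
  have hc1 : ∀ j ≤ n, c j = y (n - j) := fun j hj => if_pos hj
  have hc2 : ∀ j ≤ n', c (n + 1 + j) = y' j := fun j hj => by
    simp [c, show ¬ n + 1 + j ≤ n by omega, hj]
  have hc3 : c (n + 1 + n' + 1) = y n := by
    simp [c, show ¬ n + 1 + n' + 1 ≤ n by omega, show ¬ n + 1 + n' + 1 ≤ n + 1 + n' by omega]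
  have hk1 : ∀ j < n, k j = i (n - 1 - j) := fun j hj => if_pos hj
  have hk2 : k n = b := by simp [k]
  have hk3 : ∀ j < n', k (n + 1 + j) = i' j := fun j hj => by
    simp [k, show ¬ n + 1 + j < n by omega, show n + 1 + j ≠ n by omega, hj]
  have hk4 : k (n + 1 + n') = a := by
    simp [k, show ¬ n + 1 + n' < n by omega, show n + 1 + n' ≠ n by omega]
  have hcases : ∀ j < N, j < n ∨ j = n ∨ (∃ m < n', j = n + 1 + m) ∨
      (j = n + 1 + n' ∧ N = n + 1 + n' + 1) := by
    intro j hj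
    by_cases h1 : j ≤ n
    · omega
    · obtain ⟨m, rfl⟩ := Nat.exists_eq_add_of_le (show n + 1 ≤ j by omega)
      rcases lt_or_ge m n' with hm | hm
      · exact Or.inr (Or.inr (Or.inl ⟨m, hm, rfl⟩))
      · omega
  refine absurd (hfree N c k ?_ ?_ ?_ ?_) ?_
  · by_contra hlt
    have hN2 : N < 2 := not_le.1 hlt
    dsimp only [N] at hN2
    split_ifs at hN2 with hc
    · obtain rfl : n = 0 := by omega
      obtain rfl : n' = 0 := by omega
      exact hne hc
    · omega
  · rw [hc1 0 (by omega), Nat.sub_zero]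
    by_cases hc : y n = y' n'
    · rw [show N = n + 1 + n' from if_pos hc, hc2 n' le_rfl, hc]
    · rw [show N = n + 1 + n' + 1 from if_neg hc, hc3]
  · intro j hj
    rcases hcases j hj with hjn | rfl | ⟨m, hm, rfl⟩ | ⟨rfl, hN'⟩
    · rw [hc1 j hjn.le, hc1 (j + 1) hjn]
      have := h.step_ne (n - (j + 1)) (by omega)
      rw [show n - (j + 1) + 1 = n - j by omega] at this
      exact this.symm
    · rw [hc1 j le_rfl, Nat.sub_self]
      exact (hc2 0 (by omega)).symm ▸ hne
    · rw [hc2 m hm.le, add_assoc, hc2 (m + 1) hm]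
      exact h'.step_ne m hm
    · rw [hc2 n' le_rfl, hc3]
      exact (hNeq hN').symm
  · intro j hj
    rcases hcases j hj with hjn | rfl | ⟨m, hm, rfl⟩ | ⟨rfl, hN'⟩
    · rw [hc1 j hjn.le, hc1 (j + 1) hjn, hk1 j hjn]
      have := h.path (n - (j + 1)) (by omega)
      rw [show n - (j + 1) + 1 = n - j by omega, show n - (j + 1) = n - 1 - j by omega] at this
      rw [show n - (j + 1) = n - 1 - j by omega]
      exact (Rf _).symm this
    · rw [hc1 j le_rfl, Nat.sub_self, hk2]
      exact (hc2 0 (by omega)).symm ▸ hstart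
    · rw [hc2 m hm.le, add_assoc (n + 1), hc2 (m + 1) hm, hk3 m hm]
      exact h'.path m hm
    · rw [hc2 n' le_rfl, hc3, hk4]
      exact (Rf a).symm hend
  · rintro ⟨j, hj, hkj⟩
    rcases hcases j (by omega) with hjn | rfl | ⟨m, hm, rfl⟩ | ⟨rfl, hN'⟩
    · rcases Nat.lt_or_ge (j + 1) n with hjn' | hjn'
      · rw [hk1 j hjn, hk1 _ hjn'] at hkj
        refine h.index_ne (n - 1 - (j + 1)) (by omega) ?_
        rw [← hkj]
        congr 1
        omega
      · obtain rfl : n = j + 1 := by omega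
        rw [hk1 j hjn, hk2] at hkj
        exact h.first_ne (by omega) (by simpa using hkj)
    · rw [hk2] at hkj
      rcases Nat.eq_zero_or_pos n' with rfl | hn'
      · exact hab (hkj.trans hk4)
      · exact h'.first_ne hn' (hkj.trans (hk3 0 hn')).symm
    · rw [hk3 m hm] at hkj
      rcases Nat.lt_or_ge (m + 1) n' with hm' | hm'
      · exact h'.index_ne m hm' (hkj.trans (hk3 (m + 1) hm'))
      · obtain rfl : n' = m + 1 := by omega
        exact h'.last_ne (by omega) (hkj.trans hk4)
    · omega

/-- Reduced paths form a Borel set. -/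
theorem measurableSet_isReducedPath [StandardBorelSpace X] [Countable ι] [MeasurableSpace ι]
    [DiscreteMeasurableSpace ι] (Rf : ι → CBER X) (b a : ι) (n : ℕ) :
    MeasurableSet {q : (ℕ → X) × (ℕ → ι) | IsReducedPath Rf b a n q.1 q.2} := by
  have hy : ∀ j, Measurable fun q : (ℕ → X) × (ℕ → ι) => q.1 j := fun j =>
    (measurable_pi_apply j).comp measurable_fst
  have hi : ∀ j, Measurable fun q : (ℕ → X) × (ℕ → ι) => q.2 j := fun j =>
    (measurable_pi_apply j).comp measurable_snd
  have hpath : MeasurableSet {q : (ℕ → X) × (ℕ → ι) | IsFactorPath Rf n q.1 q.2} := by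
    have heq : {q : (ℕ → X) × (ℕ → ι) | IsFactorPath Rf n q.1 q.2} =
        ⋂ j, ⋂ (_ : j < n), ⋃ k, {q | q.2 j = k} ∩ {q | (Rf k).rel (q.1 j) (q.1 (j + 1))} := by
      ext q
      simp [IsFactorPath]
    rw [heq]
    exact .iInter fun j => .iInter fun _ => .iUnion fun k =>
      (hi j (measurableSet_singleton k)).inter (((hy j).prodMk (hy (j + 1))) (Rf k).rel_meas)
  have heq : {q : (ℕ → X) × (ℕ → ι) | IsReducedPath Rf b a n q.1 q.2} =
      {q | IsFactorPath Rf n q.1 q.2} ∩ ((⋂ j, ⋂ (_ : j < n), {q | q.1 j = q.1 (j + 1)}ᶜ) ∩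
        ((⋂ j, ⋂ (_ : j + 1 < n), {q | q.2 j = q.2 (j + 1)}ᶜ) ∩
          ((⋂ (_ : 0 < n), {q | q.2 0 = b}ᶜ) ∩ ⋂ (_ : 0 < n), {q | q.2 (n - 1) = a}ᶜ))) := by
    ext q
    simp only [mem_inter_iff, mem_iInter, mem_compl_iff, mem_ofPred_eq]
    exact ⟨fun h => ⟨h.1, h.2, h.3, h.4, h.5⟩, fun h => ⟨h.1, h.2.1, h.2.2.1, h.2.2.2.1, h.2.2.2.2⟩⟩
  rw [heq]
  exact hpath.inter ((MeasurableSet.iInter fun j => .iInter fun _ =>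
    (measurableSet_eq_fun (hy j) (hy (j + 1))).compl).inter
      ((MeasurableSet.iInter fun j => .iInter fun _ =>
        (measurableSet_eq_fun (hi j) (hi (j + 1))).compl).inter
        ((MeasurableSet.iInter fun _ => (hi 0 (measurableSet_singleton b)).compl).inter
          (MeasurableSet.iInter fun _ => (hi (n - 1) (measurableSet_singleton a)).compl))))

end ReducedPath

/-- In a free product, a subrelation of the factor `Rf b` which is inner conjugate to a
subrelation of a different factor `Rf a` is smooth. -/
theorem IsFreeProduct.smooth_of_innerConjugate {X ι : Type} [MeasurableSpace X]
    [StandardBorelSpace X] [Countable ι] {R : CBER X} {Rf : ι → CBER X}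
    (hfp : IsFreeProduct R Rf) {b a : ι} (hab : b ≠ a) {S₁ S₂ : CBER X}
    (hS₁ : S₁.IsSubrelOf (Rf a)) (hS₂ : S₂.IsSubrelOf (Rf b)) (hconj : InnerConjugate R S₁ S₂) :
    S₂.Smooth := by
  classical
  obtain ⟨hfree, -, hgen⟩ := hfp
  obtain ⟨φ, ⟨-, hφR⟩, hsrc, htgt, hφ⟩ := hconj
  let _ : MeasurableSpace ι := ⊤
  let Start : X → X → Prop := fun x u => ∃ n y i, IsReducedPath Rf b a n y i ∧
    (Rf b).rel x (y 0) ∧ (Rf a).rel (y n) (φ.toFun x) ∧ y 0 = u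
  have hφdom : ∀ x ∈ S₂.dom, φ.toFun x ∈ S₁.dom := fun x hx => htgt ▸ φ.mapsTo (hsrc ▸ hx)
  have hexists : ∀ x ∈ S₂.dom, ∃ u, Start x u := by
    intro x hx
    obtain ⟨n, y, i, hred, hxy, hyz⟩ := exists_isReducedPath Rf (hS₂.1 hx)
      (hS₁.1 (hφdom x hx)) ((hgen _ _).1 (hφR x (hsrc ▸ hx))).2
    exact ⟨y 0, n, y, i, hred, hxy, hyz, rfl⟩
  have hunique : ∀ x x' u u', S₂.rel x x' → Start x u → Start x' u' → u = u' := by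
    rintro x x' _ _ hxx' ⟨n, y, i, hred, hxy, hyz, rfl⟩ ⟨n', y', i', hred', hxy', hyz', rfl⟩
    have hd := S₂.rel_dom hxx'
    have himg := hS₁.2 _ _ ((hφ x (hsrc ▸ hd.1) x' (hsrc ▸ hd.2)).1 hxx')
    exact hfree.start_eq hab hred hred'
      ((Rf b).trans ((Rf b).symm hxy) ((Rf b).trans (hS₂.2 _ _ hxx') hxy'))
      ((Rf a).trans hyz ((Rf a).trans himg ((Rf a).symm hyz')))
  choose! s hs using hexists
  let p : X → X := fun x => if x ∈ S₂.dom then s x else x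
  have hp : ∀ x ∈ S₂.dom, p x = s x := fun x hx => if_pos hx
  have hpn : ∀ x ∉ S₂.dom, p x = x := fun x hx => if_neg hx
  let := upgradeStandardBorel X
  have hpre : ∀ A : Set X, MeasurableSet A → AnalyticSet (p ⁻¹' A) := by
    intro A hA
    let Q : ℕ → Set (X × (ℕ → X) × (ℕ → ι)) := fun n =>
      {q | q.1 ∈ S₂.dom} ∩ ({q | IsReducedPath Rf b a n q.2.1 q.2.2} ∩
        ({q | (Rf b).rel q.1 (q.2.1 0)} ∩ ({q | (Rf a).rel (q.2.1 n) (φ.toFun q.1)} ∩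
          {q | q.2.1 0 ∈ A})))
    have hy : ∀ j, Measurable fun q : X × (ℕ → X) × (ℕ → ι) => q.2.1 j := fun j =>
      (measurable_pi_apply j).comp (measurable_fst.comp measurable_snd)
    have hQ : ∀ n, MeasurableSet (Q n) := fun n =>
      (measurable_fst S₂.dom_meas).inter
        ((measurable_snd (measurableSet_isReducedPath Rf b a n)).inter
          (((measurable_fst.prodMk (hy 0)) (Rf b).rel_meas).inter
            ((((hy n).prodMk (φ.meas_toFun.comp measurable_fst)) (Rf a).rel_meas).inter
              (hy 0 hA))))
    have heq : p ⁻¹' A = ⋃ o : Option ℕ, o.elim (A \ S₂.dom) fun n => Prod.fst '' Q n := by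
      ext x
      rw [Set.mem_preimage, Set.mem_iUnion]
      constructor
      · intro hx
        by_cases hxd : x ∈ S₂.dom
        · rw [hp x hxd] at hx
          obtain ⟨n, y, i, hred, hxy, hyz, hu⟩ := hs x hxd
          exact ⟨some n, (x, y, i), ⟨hxd, hred, hxy, hyz, by simpa [hu] using hx⟩, rfl⟩
        · rw [hpn x hxd] at hx
          exact ⟨none, hx, hxd⟩
      · rintro ⟨_ | n, hx⟩
        · rw [hpn x hx.2]
          exact hx.1
        · obtain ⟨⟨x, y, i⟩, ⟨hxd, hred, hxy, hyz, hyA⟩, rfl⟩ := hx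
          rw [hp x hxd, hunique x x _ (y 0) (S₂.refl x hxd) (hs x hxd)
            ⟨n, y, i, hred, hxy, hyz, rfl⟩]
          exact hyA
    rw [heq]
    refine AnalyticSet.iUnion ?_
    rintro (_ | n)
    · exact (hA.diff S₂.dom_meas).analyticSet
    · exact (hQ n).analyticSet_image measurable_fst
  have hpm : Measurable p := fun A hA =>
    (hpre A hA).measurableSet_of_compl (by simpa using hpre Aᶜ hA.compl)
  refine CBER.Smooth.of_invariant S₂ hpm (fun u => ?_) fun x x' hxx' => ?_
  · refine (((Rf b).countable_classes u).insert u).mono fun x hx => ?_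
    have hxu : p x = u := hx
    by_cases hxd : x ∈ S₂.dom
    · rw [hp x hxd] at hxu
      obtain ⟨n, y, i, -, hxy, -, hu⟩ := hs x hxd
      rw [hu, hxu] at hxy
      exact Or.inr ((Rf b).symm hxy)
    · exact Or.inl ((hpn x hxd).symm.trans hxu)
  · have hd := S₂.rel_dom hxx'
    rw [hp x hd.1, hp x' hd.2]
    exact hunique x x' _ _ hxx' (hs x hd.1) (hs x' hd.2)

/-- In a free product `R = R₁ * R₂ * R₃`, two subrelations of `R₁` and `R₂`
that are inner conjugate in `R` are smooth. -/
theorem inner_conjugate_subrelations_of_factors_smooth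
    {X : Type} [MeasurableSpace X] [StandardBorelSpace X]
    (R R₁ R₂ R₃ : CBER X)
    (hfp : IsFreeProduct R ![R₁, R₂, R₃])
    (S₁ S₂ : CBER X)
    (hS₁ : S₁.IsSubrelOf R₁) (hS₂ : S₂.IsSubrelOf R₂)
    (hconj : InnerConjugate R S₁ S₂) :
    S₁.Smooth ∧ S₂.Smooth := by
  have h := hfp.smooth_of_innerConjugate (b := 1) (a := 0) (by decide) hS₁ hS₂ hconj
  exact ⟨h.of_innerConjugate hconj, h⟩
end

section
/- Let R = *_{j∈J} R_j be a free product decomposition of a countable Borel equivalence relation such that D(R_{j₀}) = D(R) for some j₀ ∈ J, and let U be a Borel set that is a complete section for every factor R_j. Then the restriction decomposes as R|U = (*_{j∈J} R_j|U) * T, where T is a treeable subrelation. -/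
open MeasureTheory

section LusinNovikov

open Set Topology

/-- `C` is a countable union of Borel sets on each of which `f` is injective. -/
def SigmaInjective {E X : Type*} [MeasurableSpace E] (f : E → X) (C : Set E) : Prop :=
  ∃ 𝒞 : Set (Set E), 𝒞.Countable ∧ (∀ c ∈ 𝒞, MeasurableSet c ∧ InjOn f c) ∧ C = ⋃₀ 𝒞

theorem SigmaInjective.measurableSet {E X : Type*} [MeasurableSpace E] {f : E → X} {C : Set E}
    (h : SigmaInjective f C) : MeasurableSet C := by
  obtain ⟨𝒞, h𝒞, hc, rfl⟩ := h
  exact MeasurableSet.sUnion h𝒞 fun c hc' => (hc c hc').1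

theorem SigmaInjective.iUnion {E X ι : Type*} [Countable ι] [MeasurableSpace E] {f : E → X}
    {C : ι → Set E} (h : ∀ i, SigmaInjective f (C i)) : SigmaInjective f (⋃ i, C i) := by
  choose 𝒞 h𝒞 hc hC using h
  refine ⟨⋃ i, 𝒞 i, countable_iUnion h𝒞, ?_, ?_⟩
  · intro c hc'
    obtain ⟨i, hi⟩ := mem_iUnion.1 hc'
    exact hc i c hi
  · simp only [hC, sUnion_iUnion]

theorem SigmaInjective.union {E X : Type*} [MeasurableSpace E] {f : E → X} {C c : Set E}
    (h : SigmaInjective f C) (hc : MeasurableSet c) (hf : InjOn f c) :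
    SigmaInjective f (C ∪ c) := by
  obtain ⟨𝒞, h𝒞, hc', rfl⟩ := h
  refine ⟨insert c 𝒞, h𝒞.insert c, ?_, by rw [sUnion_insert, union_comm]⟩
  rintro d (rfl | hd)
  · exact ⟨hc, hf⟩
  · exact hc' d hd

theorem SigmaInjective.empty {E X : Type*} [MeasurableSpace E] (f : E → X) :
    SigmaInjective f (∅ : Set E) :=
  ⟨∅, countable_empty, by simp, by simp⟩

theorem MeasureTheory.AnalyticSet.inter {E : Type*} [TopologicalSpace E] [T2Space E]
    {s t : Set E} (hs : AnalyticSet s) (ht : AnalyticSet t) : AnalyticSet (s ∩ t) := by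
  rw [inter_eq_iInter]
  exact AnalyticSet.iInter (by rintro (_ | _) <;> assumption)

/-- The points sharing their `f`-value with a different point of an analytic set form
an analytic set. -/
theorem MeasureTheory.AnalyticSet.exists_ne_and_eq {E X : Type*} [TopologicalSpace E]
    [PolishSpace E] [TopologicalSpace X] [T2Space X] {f : E → X} (hf : Continuous f)
    {A : Set E} (hA : AnalyticSet A) : AnalyticSet {y | ∃ a ∈ A, a ≠ y ∧ f a = f y} := by
  let : MeasurableSpace (E × E) := borel _
  have : BorelSpace (E × E) := ⟨rfl⟩
  have h₁ : AnalyticSet {p : E × E | f p.1 = f p.2} :=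
    (isClosed_eq (hf.comp continuous_fst) (hf.comp continuous_snd)).analyticSet
  have h₂ : AnalyticSet {p : E × E | p.1 ≠ p.2} :=
    (isOpen_ne_fun continuous_fst continuous_snd).measurableSet.analyticSet
  convert ((hA.preimage continuous_fst).inter (h₂.inter h₁)).image_of_continuous continuous_snd
    using 1
  ext y
  simp

/-- An analytic set on which a continuous `f` is injective is contained in a Borel set on
which `f` is injective. -/
theorem MeasureTheory.AnalyticSet.exists_measurableSet_injOn {E X : Type*} [TopologicalSpace E]
    [PolishSpace E] [MeasurableSpace E] [BorelSpace E] [TopologicalSpace X] [T2Space X]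
    {f : E → X} (hf : Continuous f) {A : Set E} (hA : AnalyticSet A) (hinj : InjOn f A) :
    ∃ B, A ⊆ B ∧ MeasurableSet B ∧ InjOn f B := by
  obtain ⟨B, hAB, hB, hBm⟩ := hA.measurablySeparable (hA.exists_ne_and_eq hf) (by
    rw [Set.disjoint_left]
    rintro y hy ⟨a, ha, hne, hay⟩
    exact hne (hinj ha hy hay))
  obtain ⟨C, hAC, hC, hCm⟩ := hA.measurablySeparable (hBm.analyticSet.exists_ne_and_eq hf) (by
    rw [Set.disjoint_left]
    rintro y hy ⟨b, hb, hne, hby⟩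
    exact Set.disjoint_left.1 hB ⟨y, hy, hne.symm, hby.symm⟩ hb)
  refine ⟨B ∩ C, subset_inter hAB hAC, hBm.inter hCm, ?_⟩
  rintro y ⟨hyB, hyC⟩ z ⟨hzB, hzC⟩ hyz
  by_contra hne
  exact Set.disjoint_left.1 hC ⟨y, hyB, hne, hyz⟩ hzC

/-- A family `𝒱` of sets is small for `f` if, outside some countable union of Borel sets on which
`f` is injective, no fibre of `f` meets all members of `𝒱`. -/
def FibreSmall {E X : Type*} [MeasurableSpace E] (f : E → X) (𝒱 : Finset (Set E)) : Prop :=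
  ∃ C, SigmaInjective f C ∧ ∀ x, ∃ V ∈ 𝒱, ∀ y ∈ V, f y = x → y ∈ C

theorem exists_split_of_not_fibreSmall {E X : Type*} [MetricSpace E] [CompleteSpace E]
    [SecondCountableTopology E] [MeasurableSpace E] [BorelSpace E] [TopologicalSpace X]
    [PolishSpace X] {f : E → X} (hf : Continuous f) {𝒱 : Finset (Set E)}
    (ho : ∀ V ∈ 𝒱, IsOpen V) (hs : ¬ FibreSmall f 𝒱) {V : Set E} (hV : V ∈ 𝒱) {ε : ENNReal}
    (hε : 0 < ε) : ∃ W : Bool → Set E, (∀ b, IsOpen (W b) ∧ closure (W b) ⊆ V ∧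
      Metric.ediam (W b) ≤ ε) ∧ Disjoint (W false) (W true) ∧
      ¬ FibreSmall f (𝒱 ∪ {W false, W true}) := by
  classical
  by_contra! hcon
  set I : Set (Bool → Set E) := {W | (∀ b, W b ∈ TopologicalSpace.countableBasis E ∧
      closure (W b) ⊆ V ∧ Metric.ediam (W b) ≤ ε) ∧ Disjoint (W false) (W true)} with hI
  have hIc : Countable I := by
    have : I ⊆ Set.pi univ fun _ => TopologicalSpace.countableBasis E :=
      fun W hW b _ => (hW.1 b).1
    exact ((Set.countable_univ_pi
      fun _ => TopologicalSpace.countable_countableBasis E).mono this).to_subtype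
  have hsm : ∀ W : I, FibreSmall f (𝒱 ∪ {W.1 false, W.1 true}) := fun W =>
    hcon W.1 (fun b => ⟨TopologicalSpace.isOpen_of_mem_countableBasis (W.2.1 b).1,
      (W.2.1 b).2⟩) W.2.2
  choose C hC hCf using hsm
  have hD := SigmaInjective.iUnion hC
  set D := ⋃ i, C i with hDdef
  set G : Set E := (V \ D) ∩ ⋂ V' : 𝒱, f ⁻¹' (f '' (V'.1 \ D)) with hG
  have hGa : AnalyticSet G := by
    have : Nonempty 𝒱 := ⟨⟨V, hV⟩⟩
    refine AnalyticSet.inter ((ho V hV).measurableSet.diff hD.measurableSet).analyticSet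
      (AnalyticSet.iInter fun V' => ?_)
    exact (((ho V' V'.2).measurableSet.diff hD.measurableSet).analyticSet.image_of_continuous
      hf).preimage hf
  have hnbhd : ∀ y ∈ V, ∀ O ∈ 𝓝 y, ∃ W ∈ TopologicalSpace.countableBasis E,
      y ∈ W ∧ closure W ⊆ V ∧ Metric.ediam W ≤ ε ∧ W ⊆ O := by
    intro y hy O hO
    obtain ⟨r, hr, hrε⟩ : ∃ r : ENNReal, 0 < r ∧ 2 * r ≤ ε :=
      ⟨ε / 2, ENNReal.half_pos hε.ne', by rw [ENNReal.mul_div_cancel (by simp) (by simp)]⟩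
    obtain ⟨K, hK, hKc, hKs⟩ := exists_mem_nhds_isClosed_subset
      (Filter.inter_mem ((ho V hV).mem_nhds hy) (Filter.inter_mem hO
        (Metric.eball_mem_nhds y hr)))
    obtain ⟨W, hW, hyW, hWK⟩ :=
      (TopologicalSpace.isBasis_countableBasis E).mem_nhds_iff.1 hK
    refine ⟨W, hW, hyW, (closure_minimal hWK hKc).trans (hKs.trans inter_subset_left), ?_,
      fun z hz => (hKs (hWK hz)).2.1⟩
    exact (Metric.ediam_mono fun z hz => (hKs (hWK hz)).2.2).trans
      (Metric.ediam_eball_le.trans hrε)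
  have hGi : InjOn f G := by
    rintro y ⟨⟨hyV, hyD⟩, hy⟩ z ⟨⟨hzV, hzD⟩, -⟩ hyz
    by_contra hne
    obtain ⟨O₁, O₂, hO₁, hO₂, hy₁, hz₂, hdisj⟩ := t2_separation hne
    obtain ⟨W₁, hW₁, hyW₁, hW₁V, hW₁ε, hW₁O⟩ := hnbhd y hyV O₁ (hO₁.mem_nhds hy₁)
    obtain ⟨W₂, hW₂, hzW₂, hW₂V, hW₂ε, hW₂O⟩ := hnbhd z hzV O₂ (hO₂.mem_nhds hz₂)
    let W : I := ⟨fun b => if b then W₂ else W₁, by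
      refine ⟨?_, ?_⟩
      · rintro (_ | _)
        · simpa using ⟨hW₁, hW₁V, hW₁ε⟩
        · simpa using ⟨hW₂, hW₂V, hW₂ε⟩
      · simpa using hdisj.mono hW₁O hW₂O⟩
    have hsub : C W ⊆ D := subset_iUnion C W
    obtain ⟨V', hV', h⟩ := hCf W (f y)
    simp only [W, Finset.mem_union, Finset.mem_insert, Finset.mem_singleton] at hV'
    rcases hV' with hV' | rfl | rfl
    · obtain ⟨y', ⟨hy'V, hy'D⟩, hy'⟩ := mem_iInter.1 hy ⟨V', hV'⟩
      exact hy'D (hsub (h y' hy'V hy'))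
    · exact hyD (hsub (h y (by simpa using hyW₁) rfl))
    · exact hzD (hsub (h z (by simpa using hzW₂) hyz.symm))
  obtain ⟨B, hGB, hBm, hBi⟩ := hGa.exists_measurableSet_injOn hf hGi
  refine hs ⟨D ∪ B, hD.union hBm hBi, fun x => ?_⟩
  by_contra! hx
  obtain ⟨y, hyV, rfl, hyDB⟩ := hx V hV
  refine hyDB (Or.inr (hGB ⟨⟨hyV, fun h => hyDB (Or.inl h)⟩, mem_iInter.2 fun V' => ?_⟩))
  obtain ⟨y', hy'V, hy', hy'DB⟩ := hx V' V'.2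
  exact ⟨y', ⟨hy'V, fun h => hy'DB (Or.inl h)⟩, hy'⟩

theorem exists_split_all_of_not_fibreSmall {E X : Type*} [MetricSpace E] [CompleteSpace E]
    [SecondCountableTopology E] [MeasurableSpace E] [BorelSpace E] [TopologicalSpace X]
    [PolishSpace X] {f : E → X} (hf : Continuous f) {𝒱 : Finset (Set E)}
    (ho : ∀ V ∈ 𝒱, IsOpen V) (hs : ¬ FibreSmall f 𝒱) {ε : ENNReal} (hε : 0 < ε) :
    ∃ 𝒲 : Finset (Set E), (∀ V ∈ 𝒲, IsOpen V) ∧ ¬ FibreSmall f 𝒲 ∧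
      ∀ V ∈ 𝒱, ∃ W : Bool → Set E, (∀ b, W b ∈ 𝒲 ∧ closure (W b) ⊆ V ∧
        Metric.ediam (W b) ≤ ε) ∧ Disjoint (W false) (W true) := by
  classical
  suffices h : ∀ 𝒮 ⊆ 𝒱, ∃ 𝒲 : Finset (Set E), 𝒱 ⊆ 𝒲 ∧ (∀ V ∈ 𝒲, IsOpen V) ∧
      ¬ FibreSmall f 𝒲 ∧ ∀ V ∈ 𝒮, ∃ W : Bool → Set E, (∀ b, W b ∈ 𝒲 ∧ closure (W b) ⊆ V ∧
        Metric.ediam (W b) ≤ ε) ∧ Disjoint (W false) (W true) by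
    obtain ⟨𝒲, -, h⟩ := h 𝒱 subset_rfl
    exact ⟨𝒲, h⟩
  intro 𝒮
  induction 𝒮 using Finset.induction_on with
  | empty => exact fun _ => ⟨𝒱, subset_rfl, ho, hs, by simp⟩
  | insert V 𝒮 _ ih =>
    intro hsub
    obtain ⟨𝒲, h𝒱, hop, hns, hsp⟩ := ih ((Finset.subset_insert V 𝒮).trans hsub)
    obtain ⟨W, hW, hWd, hWs⟩ := exists_split_of_not_fibreSmall hf hop hns
      (h𝒱 (hsub (Finset.mem_insert_self V 𝒮))) hε
    refine ⟨_, h𝒱.trans Finset.subset_union_left, ?_, hWs, ?_⟩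
    · intro V' hV'
      simp only [Finset.mem_union, Finset.mem_insert, Finset.mem_singleton] at hV'
      rcases hV' with h | rfl | rfl
      exacts [hop _ h, (hW _).1, (hW _).1]
    · intro V' hV'
      rcases Finset.mem_insert.1 hV' with rfl | hV'
      · exact ⟨W, fun b => ⟨by cases b <;> simp, (hW b).2⟩, hWd⟩
      · obtain ⟨W', hW', hd'⟩ := hsp V' hV'
        exact ⟨W', fun b => ⟨Finset.mem_union_left _ (hW' b).1, (hW' b).2⟩, hd'⟩

theorem exists_uncountable_fibre_of_not_fibreSmall {E X : Type*} [MetricSpace E]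
    [CompleteSpace E] [SecondCountableTopology E] [MeasurableSpace E] [BorelSpace E]
    [TopologicalSpace X] [PolishSpace X] {f : E → X} (hf : Continuous f)
    (hs : ¬ FibreSmall f {univ}) : ∃ x, ¬ (f ⁻¹' {x}).Countable := by
  classical
  let Good := {𝒱 : Finset (Set E) // (∀ V ∈ 𝒱, IsOpen V) ∧ ¬ FibreSmall f 𝒱}
  have hstep : ∀ (n : ℕ) (𝒱 : Good), ∃ 𝒲 : Good, ∀ V ∈ 𝒱.1, ∃ W : Bool → Set E,
      (∀ b, W b ∈ 𝒲.1 ∧ closure (W b) ⊆ V ∧ Metric.ediam (W b) ≤ ((n : ENNReal) + 1)⁻¹) ∧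
        Disjoint (W false) (W true) := by
    intro n 𝒱
    obtain ⟨𝒲, h₁, h₂, h₃⟩ := exists_split_all_of_not_fibreSmall hf 𝒱.2.1 𝒱.2.2
      (ε := ((n : ENNReal) + 1)⁻¹) (by simp)
    exact ⟨⟨𝒲, h₁, h₂⟩, h₃⟩
  choose next hnext using hstep
  let 𝒱 : ℕ → Good := fun n => Nat.rec ⟨{univ}, by simp, hs⟩ next n
  have hsplit : ∀ n (V : Set E), ∃ W : Bool → Set E, V ∈ (𝒱 n).1 →
      (∀ b, W b ∈ (𝒱 (n + 1)).1 ∧ closure (W b) ⊆ V ∧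
        Metric.ediam (W b) ≤ ((n : ENNReal) + 1)⁻¹) ∧ Disjoint (W false) (W true) := by
    intro n V
    by_cases hV : V ∈ (𝒱 n).1
    · obtain ⟨W, hW⟩ := hnext n (𝒱 n) V hV
      exact ⟨W, fun _ => hW⟩
    · exact ⟨fun _ => ∅, fun h => absurd h hV⟩
  choose c hc using hsplit
  let A : List Bool → Set E := fun l => List.rec univ (fun b l V => c l.length V b) l
  have hA : ∀ l, A l ∈ (𝒱 l.length).1 := by
    intro l
    induction l with
    | nil => exact Finset.mem_singleton_self _
    | cons b l ih => exact ((hc _ _ ih).1 b).1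
  have hmeet : ∀ n, ∃ x, ∀ V ∈ (𝒱 n).1, ∃ y ∈ V, f y = x := by
    intro n
    by_contra! h
    exact (𝒱 n).2.2 ⟨∅, SigmaInjective.empty f, fun x => by
      obtain ⟨V, hV, h⟩ := h x
      exact ⟨V, hV, fun y hy hyx => absurd hyx (h y hy)⟩⟩
  have hanti : CantorScheme.ClosureAntitone A := fun l b => ((hc _ _ (hA l)).1 b).2.1
  have hdisj : CantorScheme.Disjoint A := by
    intro l a b hab
    have := (hc _ _ (hA l)).2
    cases a <;> cases b <;> first | exact absurd rfl hab | exact this | exact this.symm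
  have hdiam : CantorScheme.VanishingDiam A := by
    intro x
    refine (Filter.tendsto_add_atTop_iff_nat 1).1 ?_
    have hlim : Filter.Tendsto (fun n : ℕ => ((n : ENNReal) + 1)⁻¹) Filter.atTop (𝓝 0) := by
      have := (Filter.tendsto_add_atTop_iff_nat 1).2 ENNReal.tendsto_inv_nat_nhds_zero
      simpa using this
    refine tendsto_of_tendsto_of_tendsto_of_le_of_le tendsto_const_nhds hlim
      (fun _ => zero_le) fun n => ?_
    exact ((hc _ _ (hA (PiNat.res x n))).1 (x n)).2.2.trans_eq (by rw [PiNat.res_length])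
  have hne : ∀ l, (A l).Nonempty := by
    intro l
    obtain ⟨x, hx⟩ := hmeet l.length
    obtain ⟨y, hy, -⟩ := hx _ (hA l)
    exact ⟨y, hy⟩
  have hdom := hanti.map_of_vanishingDiam hdiam hne
  let g : (ℕ → Bool) → E := fun α =>
    (CantorScheme.inducedMap A).2 ⟨α, hdom ▸ mem_univ α⟩
  have hg : Function.Injective g := fun α β h => congrArg Subtype.val (hdisj.map_injective h)
  have hgm : ∀ α n, g α ∈ A (PiNat.res α n) := fun α n => CantorScheme.map_mem _ n
  have hnhds : ∀ α, ∀ O ∈ 𝓝 (g α), ∃ N, ∀ n ≥ N, A (PiNat.res α n) ⊆ O := by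
    intro α O hO
    obtain ⟨r, hr, hrO⟩ := EMetric.mem_nhds_iff.1 hO
    obtain ⟨N, hN⟩ := Filter.eventually_atTop.1 ((hdiam α).eventually_lt_const hr)
    exact ⟨N, fun n hn y hy => hrO
      ((Metric.edist_le_ediam_of_mem hy (hgm α n)).trans_lt (hN n hn))⟩
  have hconst : ∀ α β, f (g α) = f (g β) := by
    intro α β
    by_contra hne
    obtain ⟨O₁, O₂, hO₁, hO₂, h₁, h₂, hdj⟩ := t2_separation hne
    obtain ⟨N₁, hN₁⟩ := hnhds α _ (hf.continuousAt.preimage_mem_nhds (hO₁.mem_nhds h₁))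
    obtain ⟨N₂, hN₂⟩ := hnhds β _ (hf.continuousAt.preimage_mem_nhds (hO₂.mem_nhds h₂))
    obtain ⟨x, hx⟩ := hmeet (max N₁ N₂)
    have hα := hA (PiNat.res α (max N₁ N₂))
    have hβ := hA (PiNat.res β (max N₁ N₂))
    rw [PiNat.res_length] at hα hβ
    obtain ⟨y, hy, hyx⟩ := hx _ hα
    obtain ⟨z, hz, hzx⟩ := hx _ hβ
    have h3 : f y ∈ O₁ := hN₁ _ (le_max_left _ _) hy
    have h4 : f z ∈ O₂ := hN₂ _ (le_max_right _ _) hz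
    exact Set.disjoint_left.1 hdj h3 (by rwa [hyx, ← hzx])
  refine ⟨f (g fun _ => false), fun hcount => ?_⟩
  have : Countable (ℕ → Bool) := by
    have hr : (range g).Countable := hcount.mono (by
      rintro _ ⟨α, rfl⟩
      exact hconst _ _)
    have := hr.to_subtype
    exact (rangeFactorization_injective.2 hg).countable
  obtain ⟨e, he⟩ := exists_surjective_nat (ℕ → Bool)
  obtain ⟨n, hn⟩ := he fun n => !e n n
  exact absurd (congrFun hn n) (by simp)

theorem Continuous.sigmaInjective_univ_of_countable_fibres {E X : Type*} [TopologicalSpace E]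
    [PolishSpace E] [MeasurableSpace E] [BorelSpace E] [TopologicalSpace X] [PolishSpace X]
    {f : E → X} (hf : Continuous f) (hcount : ∀ x, (f ⁻¹' {x}).Countable) :
    SigmaInjective f univ := by
  let := TopologicalSpace.upgradeIsCompletelyMetrizable E
  by_contra h
  obtain ⟨x, hx⟩ := exists_uncountable_fibre_of_not_fibreSmall hf (by
    rintro ⟨C, hC, hCf⟩
    have : C = univ := eq_univ_of_forall fun y => by
      obtain ⟨V, hV, hVC⟩ := hCf (f y)
      exact hVC y (Finset.mem_singleton.1 hV ▸ mem_univ y) rfl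
    exact h (this ▸ hC))
  exact hx (hcount x)

/-- **Lusin–Novikov**: a countable-to-one Borel map is injective on each piece of a countable
Borel cover. -/
theorem Measurable.sigmaInjective_univ_of_countable_fibres {E X : Type*} [MeasurableSpace E]
    [StandardBorelSpace E] [MeasurableSpace X] [StandardBorelSpace X] {f : E → X}
    (hf : Measurable f) (hcount : ∀ x, (f ⁻¹' {x}).Countable) :
    SigmaInjective f univ := by
  let := upgradeStandardBorel X
  let tE := upgradeStandardBorel E
  obtain ⟨t, ht, hft, hpt⟩ := hf.exists_continuous
  have hb : @BorelSpace E t _ := by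
    refine @BorelSpace.mk E t _ ?_
    rw [borel_eq_borel_of_le hpt tE.toPolishSpace ht]
    exact BorelSpace.measurable_eq
  exact @Continuous.sigmaInjective_univ_of_countable_fibres E X t hpt _ hb _ _ f hft hcount

/-- A Borel map with countable fibres on a Borel set `S` is injective on each piece of a countable
Borel partition of `S`. -/
theorem MeasurableSet.exists_disjoint_cover_injOn {E X : Type*} [MeasurableSpace E]
    [StandardBorelSpace E] [MeasurableSpace X] [StandardBorelSpace X] {f : E → X}
    (hf : Measurable f) {S : Set E} (hS : MeasurableSet S)
    (hcount : ∀ x, {y ∈ S | f y = x}.Countable) :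
    ∃ c : ℕ → Set E, (∀ n, MeasurableSet (c n)) ∧ (∀ n, InjOn f (c n)) ∧
      Pairwise (Function.onFun Disjoint c) ∧ ⋃ n, c n = S := by
  have := hS.standardBorel
  obtain ⟨𝒞, h𝒞, hc, hU⟩ := (hf.comp
    measurable_subtype_coe).sigmaInjective_univ_of_countable_fibres (E := S) fun x => by
      refine ((hcount x).preimage Subtype.val_injective).mono ?_
      exact fun y hy => ⟨y.2, hy⟩
  obtain ⟨d, hd⟩ := (h𝒞.insert ∅).exists_eq_range (insert_nonempty _ _)
  have hdm : ∀ n, MeasurableSet (d n) ∧ InjOn (f ∘ Subtype.val) (d n) := by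
    intro n
    have : d n ∈ insert ∅ 𝒞 := hd ▸ mem_range_self n
    rcases this with h | h
    · simp [h]
    · exact hc _ h
  have hcover : ⋃ n, d n = univ := by
    rw [← sUnion_range, ← hd, sUnion_insert, empty_union, hU]
  refine ⟨disjointed fun n => Subtype.val '' d n, ?_, ?_, disjoint_disjointed _, ?_⟩
  · exact fun n => MeasurableSet.disjointed (fun n => hS.subtype_image (hdm n).1) n
  · intro n
    refine InjOn.mono (disjointed_subset _ n) ?_
    rintro _ ⟨y, hy, rfl⟩ _ ⟨z, hz, rfl⟩ hyz
    exact congrArg _ ((hdm n).2 hy hz hyz)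
  · rw [iUnion_disjointed, ← image_iUnion, hcover, image_univ, Subtype.range_coe]

/-- A Borel map injective on a Borel set has a globally defined Borel left inverse on it. -/
theorem MeasurableSet.exists_measurable_leftInvOn {E X : Type*} [MeasurableSpace E]
    [StandardBorelSpace E] [MeasurableSpace X] [StandardBorelSpace X] [Nonempty E] {f : E → X}
    (hf : Measurable f) {S : Set E} (hS : MeasurableSet S) (hinj : InjOn f S) :
    ∃ g : X → E, Measurable g ∧ LeftInvOn g f S := by
  have := hS.standardBorel
  obtain ⟨g, hg, h⟩ := ((hf.comp measurable_subtype_coe).measurableEmbedding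
    (injOn_iff_injective.1 hinj)).exists_measurable_extend
    (measurable_subtype_coe (p := (· ∈ S))) fun _ => inferInstance
  exact ⟨g, hg, fun y hy => congrFun h ⟨y, hy⟩⟩

/-- Borel uniformization of a Borel set with countable sections. -/
theorem MeasurableSet.exists_measurable_uniformization {X Y : Type*} [MeasurableSpace X]
    [StandardBorelSpace X] [MeasurableSpace Y] [StandardBorelSpace Y] [Nonempty Y]
    {P : Set (X × Y)} (hP : MeasurableSet P) (hcount : ∀ x, {y | (x, y) ∈ P}.Countable) :
    ∃ p : X → Y, Measurable p ∧ ∀ x y, (x, y) ∈ P → (x, p x) ∈ P := by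
  rcases isEmpty_or_nonempty X with hX | hX
  · exact ⟨fun x => hX.elim x, measurable_of_empty _, fun x => hX.elim x⟩
  obtain ⟨c, hcm, hci, -, hcP⟩ := hP.exists_disjoint_cover_injOn measurable_fst fun x => by
    refine ((hcount x).image (Prod.mk x)).mono ?_
    rintro ⟨x', y⟩ ⟨h, rfl⟩
    exact ⟨y, h, rfl⟩
  choose g hg hgl using fun n => (hcm n).exists_measurable_leftInvOn measurable_fst (hci n)
  have hdm : ∀ n, MeasurableSet (Prod.fst '' c n) := fun n =>
    (hcm n).image_of_measurable_injOn measurable_fst (hci n)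
  classical
  have hex : ∀ x, ∃ n, x ∈ Prod.fst '' c n ∨ ∀ m, x ∉ Prod.fst '' c m := by
    intro x
    by_cases h : ∃ n, x ∈ Prod.fst '' c n
    · exact h.imp fun _ => Or.inl
    · exact ⟨0, Or.inr (not_exists.1 h)⟩
  have hN : Measurable fun x => Nat.find (hex x) := by
    have hnone : MeasurableSet {x | ∀ m, x ∉ Prod.fst '' c m} := by
      simp only [ofPred_forall]
      exact MeasurableSet.iInter fun m => (hdm m).compl
    exact measurable_find hex fun n => (hdm n).union hnone
  refine ⟨fun x => (g (Nat.find (hex x)) x).2, ?_, ?_⟩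
  · have hg' : Measurable fun q : X × ℕ => g q.2 q.1 := measurable_from_prod_countable_left hg
    exact measurable_snd.comp (hg'.comp (measurable_id.prodMk hN))
  · intro x y hxy
    rw [← hcP] at hxy
    obtain ⟨n, hn⟩ := mem_iUnion.1 hxy
    obtain ⟨q, hq, hqx⟩ := (Nat.find_spec (hex x)).resolve_right fun h => h n ⟨(x, y), hn, rfl⟩
    rw [← hcP]
    refine mem_iUnion.2 ⟨Nat.find (hex x), ?_⟩
    have h := hgl _ hq
    rw [hqx] at h
    simp only [h]
    rwa [show (x, q.2) = q from Prod.ext hqx.symm rfl]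

end LusinNovikov
section ReducedPaths

variable {Λ X : Type*}

/-- `RedPath step ok u l v`: there is a nonempty path from `u` to `v` whose steps are labelled
by `Λ`, with last label `l`, any two consecutive labels being related by `ok`. -/
inductive RedPath (step : Λ → X → X → Prop) (ok : Λ → Λ → Prop) (u : X) : Λ → X → Prop
  | single {l : Λ} {v : X} : step l u v → RedPath step ok u l v
  | snoc {l l' : Λ} {v v' : X} : RedPath step ok u l v → ok l l' → step l' v v' →
      RedPath step ok u l' v'

theorem RedPath.of_seq {step : Λ → X → X → Prop} {ok : Λ → Λ → Prop} {x : ℕ → X} {i : ℕ → Λ}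
    {n : ℕ} (hs : ∀ j < n + 1, step (i j) (x j) (x (j + 1)))
    (hok : ∀ j < n, ok (i j) (i (j + 1))) : RedPath step ok (x 0) (i n) (x (n + 1)) := by
  induction n with
  | zero => exact .single (hs 0 (by omega))
  | succ n ih =>
    exact .snoc (ih (fun j hj => hs j (by omega)) fun j hj => hok j (by omega))
      (hok n (by omega)) (hs (n + 1) (by omega))

theorem RedPath.exists_seq {step : Λ → X → X → Prop} {ok : Λ → Λ → Prop} {u v : X} {l : Λ}
    (h : RedPath step ok u l v) : ∃ (n : ℕ) (x : ℕ → X) (i : ℕ → Λ), x 0 = u ∧ x (n + 1) = v ∧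
      i n = l ∧ (∀ j < n + 1, step (i j) (x j) (x (j + 1))) ∧
      ∀ j < n, ok (i j) (i (j + 1)) := by
  induction h with
  | @single l v h =>
    exact ⟨0, fun k => if k = 0 then u else v, fun _ => l, by simp, by simp, rfl,
      fun j hj => by obtain rfl : j = 0 := by omega
                     simpa using h, by simp⟩
  | @snoc l l' v v' _ hok hs ih =>
    obtain ⟨n, x, i, h0, hn, hi, hst, hk⟩ := ih
    refine ⟨n + 1, fun k => if k = n + 2 then v' else x k, fun k => if k = n + 1 then l' else i k,
      by simpa using h0, by simp, by simp, fun j hj => ?_, fun j hj => ?_⟩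
    · rcases Nat.lt_succ_iff_lt_or_eq.1 hj with hj | rfl
      · simpa [show j ≠ n + 1 by omega, show j ≠ n + 2 by omega] using hst j hj
      · simpa [hn] using hs
    · rcases Nat.lt_succ_iff_lt_or_eq.1 hj with hj | rfl
      · simpa [show j ≠ n + 1 by omega, show j ≠ n by omega] using hk j hj
      · simpa [hi] using hok

/-- If consecutive labels violating `ok` always cancel, every path reduces. -/
theorem RedPath.of_reflTransGen {step : Λ → X → X → Prop} {ok : Λ → Λ → Prop}
    (hcancel : ∀ l l' a b c, step l a b → step l' b c → ¬ ok l l' → a = c) {u v : X}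
    (h : Relation.ReflTransGen (fun a b => ∃ l, step l a b) u v) :
    u = v ∨ ∃ l, RedPath step ok u l v := by
  induction h with
  | refl => exact .inl rfl
  | tail _ h ih =>
    obtain ⟨l', hl'⟩ := h
    rcases ih with rfl | ⟨l, hl⟩
    · exact .inr ⟨l', .single hl'⟩
    · by_cases hok : ok l l'
      · exact .inr ⟨l', .snoc hl hok hl'⟩
      · cases hl with
        | single h => exact .inl (hcancel _ _ _ _ _ h hl' hok)
        | snoc h₁ _ h₂ =>
          obtain rfl := hcancel _ _ _ _ _ h₂ hl' hok
          exact .inr ⟨_, h₁⟩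

end ReducedPaths

section Words

variable {X J : Type}

/-- Steps of a family of relations between distinct points. -/
def NontrivialStep (r : J → X → X → Prop) (i : J) (a b : X) : Prop :=
  r i a b ∧ a ≠ b

/-- Alternating paths from `u` to `v` with last step in the `i`-th relation. -/
abbrev AltPath (r : J → X → X → Prop) (u : X) (i : J) (v : X) : Prop :=
  RedPath (NontrivialStep r) (· ≠ ·) u i v

theorem FreelyIndep.not_altPath_self [MeasurableSpace X] {Rf : J → CBER X} (h : FreelyIndep Rf)
    (u : X) (i : J) : ¬ AltPath (fun i => (Rf i).rel) u i u := by
  intro hp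
  obtain ⟨n, x, i, h0, hn, -, hs, hok⟩ := hp.exists_seq
  rcases Nat.eq_zero_or_pos n with rfl | hpos
  · exact (hs 0 (by omega)).2 (by rw [h0, hn])
  · obtain ⟨j, hj, hij⟩ := h (n + 1) x i (by omega) (by rw [h0, hn])
      (fun j hj => (hs j hj).2) fun j hj => (hs j hj).1
    exact hok j (by omega) hij

theorem freelyIndep_of_not_altPath_self [MeasurableSpace X] {Rf : J → CBER X}
    (h : ∀ u i, ¬ AltPath (fun i => (Rf i).rel) u i u) : FreelyIndep Rf := by
  intro n x i hn hx hne hrel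
  by_contra! hcon
  obtain ⟨n, rfl⟩ : ∃ m, n = m + 1 := ⟨n - 1, by omega⟩
  have := RedPath.of_seq (step := NontrivialStep fun i => (Rf i).rel) (ok := (· ≠ ·))
    (x := x) (i := i) (n := n) (fun j hj => ⟨hrel j hj, hne j hj⟩) fun j hj => hcon j (by omega)
  rw [hx] at this
  exact h _ _ this

/-- Oriented edges between the two images `p j₀ x` and `p j x` of a point `x`: they are
labelled by `j`, `x` and an orientation. -/
def edgeStep (p : J → X → X) (S : J → Set X) (j₀ : J) : J × X × Bool → X → X → Prop
  | (j, x, true), a, b => x ∈ S j ∧ p j₀ x = a ∧ p j x = b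
  | (j, x, false), a, b => x ∈ S j ∧ p j x = a ∧ p j₀ x = b

/-- Two consecutive edges do not backtrack. -/
def EdgeOk (e e' : J × X × Bool) : Prop :=
  ¬ (e.1 = e'.1 ∧ e.2.1 = e'.2.1 ∧ e.2.2 ≠ e'.2.2)

/-- Steps of mixed words: moves inside `U` along a relation `r j`, or edges. -/
def wordStep (r : J → X → X → Prop) (U : Set X) (p : J → X → X) (S : J → Set X) (j₀ : J) :
    J ⊕ (J × X × Bool) → X → X → Prop
  | .inl j, a, b => r j a b ∧ a ∈ U ∧ b ∈ U ∧ a ≠ b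
  | .inr e, a, b => edgeStep p S j₀ e a b

/-- Two consecutive letters of a mixed word admit no reduction. -/
def WordOk : J ⊕ (J × X × Bool) → J ⊕ (J × X × Bool) → Prop
  | .inl j, .inl j' => j ≠ j'
  | .inr e, .inr e' => EdgeOk e e'
  | _, _ => True

/-- The path from `u` to `w` is empty or alternating with last step outside the `i`-th
relation. -/
def PreAlt (r : J → X → X → Prop) (u : X) (i : J) (w : X) : Prop :=
  w = u ∨ ∃ k, k ≠ i ∧ AltPath r u k w

theorem PreAlt.step {r : J → X → X → Prop} {u w v : X} {i : J} (h : PreAlt r u i w)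
    (hr : r i w v) (hne : w ≠ v) : AltPath r u i v := by
  rcases h with rfl | ⟨k, hk, h⟩
  · exact .single ⟨hr, hne⟩
  · exact .snoc h hk ⟨hr, hne⟩

/-- What is known about the alternating path underlying a reduced mixed word from `u` to `v`, in
terms of its last letter. -/
def WordState (r : J → X → X → Prop) (U : Set X) (p : J → X → X) (S : J → Set X) (j₀ : J)
    (u : X) : J ⊕ (J × X × Bool) → X → Prop
  | .inl i, v => v ∈ U ∧ ∃ w, PreAlt r u i w ∧ r i w v ∧ w ≠ v ∧ (w ∉ U → p i w ≠ v)
  | .inr (j, x, true), v => x ∈ S j ∧ p j x = v ∧ PreAlt r u j x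
  | .inr (j, x, false), v => x ∈ S j ∧ p j₀ x = v ∧ AltPath r u j x

/-- Retractions `p j` onto `U` along the relations `r j`, and the sets `S j` of points outside
`U` in the domain of `r j`, for `j ≠ j₀`. -/
structure RetractionData (r : J → X → X → Prop) (U : Set X) (p : J → X → X) (S : J → Set X)
    (j₀ : J) : Prop where
  symm : ∀ {j a b}, r j a b → r j b a
  trans : ∀ {j a b c}, r j a b → r j b c → r j a c
  not_mem : ∀ {j x}, x ∈ S j → x ∉ U
  ne : ∀ {j x}, x ∈ S j → j ≠ j₀
  rel : ∀ {j x}, x ∈ S j → r j x (p j x)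
  rel₀ : ∀ {j x}, x ∈ S j → r j₀ x (p j₀ x)
  mem : ∀ {j x}, x ∈ S j → p j x ∈ U
  mem₀ : ∀ {j x}, x ∈ S j → p j₀ x ∈ U

variable {r : J → X → X → Prop} {U : Set X} {p : J → X → X} {S : J → Set X} {j₀ : J} {u : X}

theorem RetractionData.altPath_of_wordState (h : RetractionData r U p S j₀)
    {l : J ⊕ (J × X × Bool)} {v : X} (hl : WordState r U p S j₀ u l v) :
    ∃ i, AltPath r u i v := by
  rcases l with i | ⟨j, x, _ | _⟩
  · obtain ⟨-, w, hw, hr, hne, -⟩ := hl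
    exact ⟨i, hw.step hr hne⟩
  · obtain ⟨hx, rfl, ha⟩ := hl
    exact ⟨j₀, .snoc ha (h.ne hx) ⟨h.rel₀ hx, fun e => h.not_mem hx (e ▸ h.mem₀ hx)⟩⟩
  · obtain ⟨hx, rfl, ha⟩ := hl
    exact ⟨j, ha.step (h.rel hx) fun e => h.not_mem hx (e ▸ h.mem hx)⟩

/-- Leaving `U` after a move. -/
theorem RetractionData.altPath_of_move (h : RetractionData r U p S j₀) {i k : J} {v y : X}
    (hl : WordState r U p S j₀ u (.inl i) v) (hy : y ∉ U) (hr : r k v y) (hp : p k y = v) :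
    AltPath r u k y := by
  obtain ⟨hv, w, hw, hwv, hne, hwp⟩ := hl
  by_cases hik : i = k
  · subst hik
    refine hw.step (h.trans hwv hr) ?_
    rintro rfl
    exact hwp hy hp
  · exact .snoc (hw.step hwv hne) hik ⟨hr, fun e => hy (e ▸ hv)⟩

theorem RetractionData.wordState_single (h : RetractionData r U p S j₀)
    {l : J ⊕ (J × X × Bool)} {v : X} (hl : wordStep r U p S j₀ l u v) :
    WordState r U p S j₀ u l v := by
  rcases l with i | ⟨j, x, _ | _⟩
  · obtain ⟨hr, hu, hv, hne⟩ := hl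
    exact ⟨hv, u, .inl rfl, hr, hne, fun h => absurd hu h⟩
  · obtain ⟨hx, rfl, rfl⟩ := hl
    exact ⟨hx, rfl, .single ⟨h.symm (h.rel hx), fun e => h.not_mem hx (e ▸ h.mem hx)⟩⟩
  · obtain ⟨hx, rfl, rfl⟩ := hl
    exact ⟨hx, rfl, .inr ⟨j₀, (h.ne hx).symm,
      .single ⟨h.symm (h.rel₀ hx), fun e => h.not_mem hx (e ▸ h.mem₀ hx)⟩⟩⟩

theorem RetractionData.wordState_snoc (h : RetractionData r U p S j₀)
    {l l' : J ⊕ (J × X × Bool)} {v v' : X} (hs : WordState r U p S j₀ u l v) (hok : WordOk l l')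
    (hl : wordStep r U p S j₀ l' v v') : WordState r U p S j₀ u l' v' := by
  have hne : ∀ {j x}, x ∈ S j → x ≠ p j x := fun hx e => h.not_mem hx (e ▸ h.mem hx)
  have hne₀ : ∀ {j x}, x ∈ S j → x ≠ p j₀ x := fun hx e => h.not_mem hx (e ▸ h.mem₀ hx)
  rcases l' with i | ⟨k, y, _ | _⟩
  · obtain ⟨hr, hv, hv', hvv'⟩ := hl
    refine ⟨hv', ?_⟩
    rcases l with i' | ⟨j, x, _ | _⟩
    · obtain ⟨-, w, hw, hwv, hwne, -⟩ := hs
      exact ⟨v, .inr ⟨i', hok, hw.step hwv hwne⟩, hr, hvv', fun h => absurd hv h⟩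
    · obtain ⟨hx, rfl, ha⟩ := hs
      by_cases hi : j₀ = i
      · subst hi
        exact ⟨x, .inr ⟨j, h.ne hx, ha⟩, h.trans (h.rel₀ hx) hr,
          fun e => h.not_mem hx (e ▸ hv'), fun _ => hvv'⟩
      · exact ⟨_, .inr ⟨j₀, hi, .snoc ha (h.ne hx) ⟨h.rel₀ hx, hne₀ hx⟩⟩, hr, hvv',
          fun h => absurd hv h⟩
    · obtain ⟨hx, rfl, ha⟩ := hs
      by_cases hi : j = i
      · subst hi
        exact ⟨x, ha, h.trans (h.rel hx) hr, fun e => h.not_mem hx (e ▸ hv'), fun _ => hvv'⟩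
      · exact ⟨_, .inr ⟨j, hi, ha.step (h.rel hx) (hne hx)⟩, hr, hvv', fun h => absurd hv h⟩
  · obtain ⟨hy, hpy, rfl⟩ := hl
    refine ⟨hy, rfl, ?_⟩
    rcases l with i' | ⟨j, x, _ | _⟩
    · exact h.altPath_of_move hs (h.not_mem hy) (hpy ▸ h.symm (h.rel hy)) hpy
    · obtain ⟨hx, rfl, ha⟩ := hs
      exact .snoc (.snoc ha (h.ne hx) ⟨h.rel₀ hx, hne₀ hx⟩) (h.ne hy).symm
        (hpy ▸ ⟨h.symm (h.rel hy), (hne hy).symm⟩)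
    · obtain ⟨hx, rfl, ha⟩ := hs
      by_cases hjk : j = k
      · subst hjk
        refine ha.step (h.trans (h.rel hx) (hpy ▸ h.symm (h.rel hy))) ?_
        rintro rfl
        exact hok ⟨rfl, rfl, by simp⟩
      · exact .snoc (ha.step (h.rel hx) (hne hx)) hjk
          (hpy ▸ ⟨h.symm (h.rel hy), (hne hy).symm⟩)
  · obtain ⟨hy, hpy, rfl⟩ := hl
    refine ⟨hy, rfl, ?_⟩
    rcases l with i' | ⟨j, x, _ | _⟩
    · exact .inr ⟨j₀, (h.ne hy).symm, h.altPath_of_move hs (h.not_mem hy)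
        (hpy ▸ h.symm (h.rel₀ hy)) hpy⟩
    · obtain ⟨hx, rfl, ha⟩ := hs
      by_cases hxy : x = y
      · subst hxy
        refine .inr ⟨j, fun e => hok ⟨e, rfl, by simp⟩, ha⟩
      · exact .inr ⟨j₀, (h.ne hy).symm, .snoc ha (h.ne hx)
          ⟨h.trans (h.rel₀ hx) (hpy ▸ h.symm (h.rel₀ hy)), hxy⟩⟩
    · obtain ⟨hx, rfl, ha⟩ := hs
      exact .inr ⟨j₀, (h.ne hy).symm, .snoc (ha.step (h.rel hx) (hne hx)) (h.ne hx)
        (hpy ▸ ⟨h.symm (h.rel₀ hy), (hne₀ hy).symm⟩)⟩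

/-- A reduced mixed word cannot be closed when the underlying relations are free. -/
theorem RetractionData.not_redPath_self (h : RetractionData r U p S j₀)
    (hfree : ∀ u i, ¬ AltPath r u i u) (l : J ⊕ (J × X × Bool)) :
    ¬ RedPath (wordStep r U p S j₀) WordOk u l u := by
  intro hp
  have key : ∀ {l v}, RedPath (wordStep r U p S j₀) WordOk u l v →
      WordState r U p S j₀ u l v := by
    intro l v hp
    induction hp with
    | single hl => exact h.wordState_single hl
    | snoc _ hok hl ih => exact h.wordState_snoc ih hok hl
  obtain ⟨i, hi⟩ := h.altPath_of_wordState (key hp)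
  exact hfree u i hi

/-- Inserting a reduced path of edges after a mixed word that is empty or ends with a move. -/
theorem RedPath.append_edges {v v' : X} {e : J × X × Bool}
    (hu : v = u ∨ ∃ j, RedPath (wordStep r U p S j₀) WordOk u (.inl j) v)
    (he : RedPath (edgeStep p S j₀) EdgeOk v e v') :
    RedPath (wordStep r U p S j₀) WordOk u (.inr e) v' := by
  induction he with
  | single he =>
    rcases hu with rfl | ⟨j, hj⟩
    · exact .single he
    · exact .snoc hj trivial he
  | snoc _ hok he ih => exact .snoc ih hok he

/-- Backtracking edges cancel. -/
theorem edgeStep_cancel {e e' : J × X × Bool} {a b c : X} (h : edgeStep p S j₀ e a b)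
    (h' : edgeStep p S j₀ e' b c) (hok : ¬ EdgeOk e e') : a = c := by
  obtain ⟨j, x, ε⟩ := e
  obtain ⟨j', x', ε'⟩ := e'
  simp only [EdgeOk, not_not] at hok
  obtain ⟨rfl, rfl, hε⟩ := hok
  cases ε <;> cases ε'
  · exact absurd rfl hε
  · exact h.2.1.symm.trans h'.2.2
  · exact h.2.1.symm.trans h'.2.2
  · exact absurd rfl hε

/-- The relations restricted to `U`, together with a relation generated by the edges, admit no
closed alternating path. -/
theorem RetractionData.not_altPath_option_self (h : RetractionData r U p S j₀)
    (hfree : ∀ u i, ¬ AltPath r u i u) {t : X → X → Prop}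
    (ht : ∀ a b, t a b → Relation.ReflTransGen (fun a b => ∃ e, edgeStep p S j₀ e a b) a b)
    {s : Option J → X → X → Prop} (hsn : ∀ a b, s none a b → t a b)
    (hss : ∀ j a b, s (some j) a b → r j a b ∧ a ∈ U ∧ b ∈ U) (i : Option J) :
    ¬ AltPath s u i u := by
  have hedge : ∀ a b, s none a b → a ≠ b → ∃ e, RedPath (edgeStep p S j₀) EdgeOk a e b :=
    fun a b hab hne => (RedPath.of_reflTransGen (fun _ _ _ _ _ => edgeStep_cancel)
      (ht a b (hsn a b hab))).resolve_left hne
  have key : ∀ {i v}, AltPath s u i v →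
      ∃ l : J ⊕ (J × X × Bool), l.getLeft? = i ∧
        RedPath (wordStep r U p S j₀) WordOk u l v := by
    intro i v hp
    induction hp with
    | @single i v hs =>
      obtain ⟨hs, hne⟩ := hs
      rcases i with _ | j
      · obtain ⟨e, he⟩ := hedge _ _ hs hne
        exact ⟨.inr e, rfl, .append_edges (.inl rfl) he⟩
      · obtain ⟨hr, ha, hb⟩ := hss _ _ _ hs
        exact ⟨.inl j, rfl, .single ⟨hr, ha, hb, hne⟩⟩
    | @snoc i i' v v' _ hok hs ih =>
      obtain ⟨l, hl, hp⟩ := ih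
      obtain ⟨hs, hne⟩ := hs
      rcases i' with _ | j
      · obtain ⟨e, he⟩ := hedge _ _ hs hne
        rcases l with k | e'
        · exact ⟨.inr e, rfl, .append_edges (.inr ⟨k, hp⟩) he⟩
        · exact absurd hl.symm hok
      · obtain ⟨hr, ha, hb⟩ := hss _ _ _ hs
        refine ⟨.inl j, rfl, .snoc hp ?_ ⟨hr, ha, hb, hne⟩⟩
        rcases l with k | e'
        · rintro rfl
          exact hok hl.symm
        · trivial
  intro hp
  obtain ⟨l, -, hl⟩ := key hp
  exact h.not_redPath_self hfree l hl

end Words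

section Graphings

variable {X : Type} [MeasurableSpace X]

theorem Relation.EqvGen.reflTransGen_of_le {α : Type*} {r s : α → α → Prop}
    (hs : ∀ {a b}, s a b → s b a) (hrs : ∀ a b, r a b → s a b) {a b : α}
    (h : Relation.EqvGen r a b) : Relation.ReflTransGen s a b := by
  have hsymm : ∀ {a b}, Relation.ReflTransGen s a b → Relation.ReflTransGen s b a := by
    intro a b h
    induction h with
    | refl => exact .refl
    | tail _ h ih => exact .head (hs h) ih
  induction h with
  | rel _ _ h => exact .single (hrs _ _ h)
  | refl => exact .refl
  | symm _ _ _ ih => exact hsymm ih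
  | trans _ _ _ _ _ ih ih' => exact ih.trans ih'

theorem PBIStep.symm {φ : PBI X} {ε : Bool} {a b : X} (h : PBIStep φ ε a b) :
    PBIStep φ (!ε) b a := by
  cases ε
  · obtain ⟨ha, rfl⟩ := h
    exact ⟨φ.mapsTo_inv ha, φ.right_inv a ha⟩
  · obtain ⟨ha, rfl⟩ := h
    exact ⟨φ.mapsTo ha, φ.left_inv a ha⟩

/-- The pairs joined by a word in a graphing. -/
def wordGraph {ι : Type} (Φ : ι → PBI X) : List (ι × Bool) → Set (X × X)
  | [] => {q | q.1 = q.2}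
  | (i, ε) :: w => {q | ∃ c, PBIStep (Φ i) ε q.1 c ∧ (c, q.2) ∈ wordGraph Φ w}

theorem measurableSet_wordGraph [StandardBorelSpace X] {ι : Type} (Φ : ι → PBI X)
    (w : List (ι × Bool)) : MeasurableSet (wordGraph Φ w) := by
  induction w with
  | nil => exact measurableSet_eq_fun measurable_fst measurable_snd
  | cons l w ih =>
    obtain ⟨i, _ | _⟩ := l
    · have : wordGraph Φ ((i, false) :: w) = Prod.fst ⁻¹' (Φ i).tgt ∩
          (fun q : X × X => ((Φ i).invFun q.1, q.2)) ⁻¹' wordGraph Φ w := by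
        ext q
        simp [wordGraph, PBIStep, and_assoc]
      rw [this]
      exact (measurable_fst (Φ i).tgt_meas).inter
        ((((Φ i).meas_invFun.comp measurable_fst).prodMk measurable_snd) ih)
    · have : wordGraph Φ ((i, true) :: w) = Prod.fst ⁻¹' (Φ i).src ∩
          (fun q : X × X => ((Φ i).toFun q.1, q.2)) ⁻¹' wordGraph Φ w := by
        ext q
        simp [wordGraph, PBIStep, and_assoc]
      rw [this]
      exact (measurable_fst (Φ i).src_meas).inter
        ((((Φ i).meas_toFun.comp measurable_fst).prodMk measurable_snd) ih)

theorem exists_mem_wordGraph_iff {ι : Type} (Φ : ι → PBI X) (a b : X) :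
    (∃ w, (a, b) ∈ wordGraph Φ w) ↔
      Relation.EqvGen (fun a b => ∃ i, a ∈ (Φ i).src ∧ (Φ i).toFun a = b) a b := by
  constructor
  · rintro ⟨w, hw⟩
    induction w generalizing a with
    | nil =>
      obtain rfl : a = b := hw
      exact .refl _
    | cons l w ih =>
      obtain ⟨i, ε⟩ := l
      obtain ⟨c, hc, hw⟩ := hw
      refine .trans _ _ _ ?_ (ih c hw)
      cases ε
      · exact .symm _ _ (.rel _ _ ⟨i, hc.symm⟩)
      · exact .rel _ _ ⟨i, hc⟩
  · intro h
    have h' : Relation.ReflTransGen (fun a b => ∃ i ε, PBIStep (Φ i) ε a b) a b :=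
      h.reflTransGen_of_le (fun ⟨i, ε, h⟩ => ⟨i, _, h.symm⟩) fun _ _ ⟨i, h⟩ => ⟨i, true, h⟩
    clear h
    induction h' using Relation.ReflTransGen.head_induction_on with
    | refl => exact ⟨[], rfl⟩
    | head h _ ih =>
      obtain ⟨i, ε, h⟩ := h
      obtain ⟨w, hw⟩ := ih
      exact ⟨(i, ε) :: w, _, h, hw⟩

/-- A countable graphing inside a countable Borel equivalence relation generates one. -/
theorem exists_generatesCBER [StandardBorelSpace X] {ι : Type} [Countable ι] (Φ : ι → PBI X)
    (R : CBER X) (h : ∀ i, R.InPseudogroup (Φ i)) :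
    ∃ T : CBER X, GeneratesCBER Φ T ∧ T.IsSubrelOf R := by
  set g : X → X → Prop := fun a b => ∃ i, a ∈ (Φ i).src ∧ (Φ i).toFun a = b with hg
  set D : Set X := ⋃ i, ((Φ i).src ∪ (Φ i).tgt) with hD
  have hDm : MeasurableSet D := .iUnion fun i => (Φ i).src_meas.union (Φ i).tgt_meas
  have hgD : ∀ {a b}, g a b → a ∈ D ∧ b ∈ D := by
    rintro a b ⟨i, ha, rfl⟩
    exact ⟨Set.mem_iUnion.2 ⟨i, .inl ha⟩, Set.mem_iUnion.2 ⟨i, .inr ((Φ i).mapsTo ha)⟩⟩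
  have hmem : ∀ {a b}, Relation.EqvGen g a b → (a ∈ D ↔ b ∈ D) := by
    intro a b h
    induction h with
    | rel _ _ h => exact ⟨fun _ => (hgD h).2, fun _ => (hgD h).1⟩
    | refl => exact Iff.rfl
    | symm _ _ _ ih => exact ih.symm
    | trans _ _ _ _ _ ih ih' => exact ih.trans ih'
  have hDR : D ⊆ R.dom := by
    refine Set.iUnion_subset fun i => Set.union_subset (h i).1 fun y hy => ?_
    rw [← (Φ i).right_inv y hy]
    exact (R.rel_dom ((h i).2 _ ((Φ i).mapsTo_inv hy))).2
  have hR : ∀ {a b}, Relation.EqvGen g a b → a ∈ D → R.rel a b := by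
    intro a b h'
    induction h' with
    | rel _ _ h' =>
      obtain ⟨i, ha, rfl⟩ := h'
      exact fun _ => (h i).2 _ ha
    | refl => exact fun ha => R.refl _ (hDR ha)
    | symm _ _ h' ih => exact fun ha => R.symm (ih ((hmem h').2 ha))
    | trans _ _ _ h' _ ih ih' => exact fun ha => R.trans (ih ha) (ih' ((hmem h').1 ha))
  refine ⟨{ dom := D
            dom_meas := hDm
            rel := fun a b => a ∈ D ∧ Relation.EqvGen g a b
            rel_meas := ?_
            rel_dom := fun h => ⟨h.1, (hmem h.2).1 h.1⟩
            refl := fun x hx => ⟨hx, .refl x⟩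
            symm := fun h => ⟨(hmem h.2).1 h.1, h.2.symm⟩
            trans := fun h h' => ⟨h.1, h.2.trans _ _ _ h'.2⟩
            countable_classes := fun x =>
              (R.countable_classes x).mono fun y hy => hR hy.2 hy.1 },
    ⟨rfl, fun i => ⟨?_, fun x hx => ⟨(hgD ⟨i, hx, rfl⟩).1, .rel _ _ ⟨i, hx, rfl⟩⟩⟩,
      fun x y => Iff.rfl⟩, hDR, fun x y hxy => hR hxy.2 hxy.1⟩
  · have : {q : X × X | q.1 ∈ D ∧ Relation.EqvGen g q.1 q.2} =
        Prod.fst ⁻¹' D ∩ ⋃ w, wordGraph Φ w := by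
      ext ⟨a, b⟩
      simp [← exists_mem_wordGraph_iff, hg]
    rw [this]
    exact (measurable_fst hDm).inter (.iUnion (measurableSet_wordGraph Φ))
  · exact fun x hx => (hgD ⟨i, hx, rfl⟩).1

/-- The partial isomorphism `f x ↦ g x`, for `x` in a set on which `f` and `g` are injective. -/
theorem exists_PBI_of_injOn [StandardBorelSpace X] {f g : X → X} (hf : Measurable f)
    (hg : Measurable g) {A : Set X} (hA : MeasurableSet A) (hfA : Set.InjOn f A)
    (hgA : Set.InjOn g A) : ∃ φ : PBI X, φ.src = f '' A ∧ φ.tgt = g '' A ∧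
      (∀ x ∈ A, φ.toFun (f x) = g x) ∧ ∀ x ∈ A, φ.invFun (g x) = f x := by
  rcases isEmpty_or_nonempty X with hX | hX
  · exact ⟨⟨f '' A, g '' A, Set.subsingleton_of_subsingleton.measurableSet,
      Set.subsingleton_of_subsingleton.measurableSet, id, id, measurable_id,
      measurable_id, fun x => hX.elim x, fun x => hX.elim x, fun x => hX.elim x,
      fun x => hX.elim x⟩, rfl, rfl, fun x => hX.elim x, fun x => hX.elim x⟩
  obtain ⟨f', hf', hff'⟩ := hA.exists_measurable_leftInvOn hf hfA
  obtain ⟨g', hg', hgg'⟩ := hA.exists_measurable_leftInvOn hg hgA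
  have h₁ : ∀ x ∈ A, g (f' (f x)) = g x := fun x hx => by rw [hff' hx]
  have h₂ : ∀ x ∈ A, f (g' (g x)) = f x := fun x hx => by rw [hgg' hx]
  refine ⟨⟨f '' A, g '' A, hA.image_of_measurable_injOn hf hfA,
    hA.image_of_measurable_injOn hg hgA, g ∘ f', f ∘ g', hg.comp hf', hf.comp hg', ?_, ?_, ?_,
    ?_⟩, rfl, rfl, h₁, h₂⟩
  · rintro _ ⟨x, hx, rfl⟩
    exact ⟨x, hx, (h₁ x hx).symm⟩
  · rintro _ ⟨x, hx, rfl⟩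
    exact ⟨x, hx, (h₂ x hx).symm⟩
  · rintro _ ⟨x, hx, rfl⟩
    simp only [Function.comp, h₁ x hx, h₂ x hx]
  · rintro _ ⟨x, hx, rfl⟩
    simp only [Function.comp, h₁ x hx, h₂ x hx]

/-- A Borel retraction of the domain onto a complete section, moving points inside their
classes. -/
theorem CBER.IsCompleteSection.exists_retraction [StandardBorelSpace X] {R : CBER X} {U : Set X}
    (h : R.IsCompleteSection U) : ∃ p : X → X, Measurable p ∧ (∀ x ∈ U, p x = x) ∧
      ∀ x ∈ R.dom, R.rel x (p x) ∧ p x ∈ U := by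
  classical
  rcases isEmpty_or_nonempty X with hX | hX
  · exact ⟨id, measurable_id, fun x => hX.elim x, fun x => hX.elim x⟩
  obtain ⟨hU, hUR, hex⟩ := h
  obtain ⟨p, hp, hpP⟩ := (R.rel_meas.inter (measurable_snd hU)).exists_measurable_uniformization
    fun x => (R.countable_classes x).mono fun y hy => hy.1
  refine ⟨fun x => if x ∈ U then x else p x, measurable_id.ite hU hp, fun x hx => if_pos hx,
    fun x hx => ?_⟩
  by_cases hxU : x ∈ U
  · simpa only [if_pos hxU] using And.intro (R.refl x hx) hxU
  · obtain ⟨y, hy, hxy⟩ := hex x hx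
    simp only [if_neg hxU]
    exact hpP x y ⟨hxy, hy⟩

/-- Countably many countable-to-one Borel maps `f, p j` are simultaneously injective on the
pieces of a countable Borel partition of their domains. -/
theorem exists_pieces_injOn [StandardBorelSpace X] {J : Type} [Countable J] [Nonempty J]
    {f : X → X} (hf : Measurable f) {p : J → X → X} (hp : ∀ j, Measurable (p j)) {S : J → Set X}
    (hS : ∀ j, MeasurableSet (S j)) (hfc : ∀ j x, {y ∈ S j | f y = x}.Countable)
    (hpc : ∀ j x, {y ∈ S j | p j y = x}.Countable) :
    ∃ (lab : ℕ → J) (A : ℕ → Set X), (∀ k, MeasurableSet (A k)) ∧ (∀ k, Set.InjOn f (A k)) ∧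
      (∀ k, Set.InjOn (p (lab k)) (A k)) ∧ (∀ k, A k ⊆ S (lab k)) ∧
      (∀ j, ∀ x ∈ S j, ∃ k, lab k = j ∧ x ∈ A k) ∧
      ∀ k k' x, x ∈ A k → x ∈ A k' → lab k = lab k' → k = k' := by
  choose c hcm hci hcd hcS using fun j => (hS j).exists_disjoint_cover_injOn hf (hfc j)
  choose d hdm hdi hdd hdS using fun j => (hS j).exists_disjoint_cover_injOn (hp j) (hpc j)
  obtain ⟨e, he⟩ := exists_injective_nat (J × ℕ × ℕ)
  let lab : ℕ → J × ℕ × ℕ := Function.invFun e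
  let A : ℕ → Set X := fun k =>
    {x | e (lab k) = k ∧ x ∈ c (lab k).1 (lab k).2.1 ∩ d (lab k).1 (lab k).2.2}
  have hlab : ∀ i, lab (e i) = i := Function.leftInverse_invFun he
  have huniq : ∀ {c : ℕ → Set X}, Pairwise (Function.onFun Disjoint c) →
      ∀ {m n x}, x ∈ c m → x ∈ c n → m = n := fun hc m n x hm hn => by
    by_contra hne
    exact Set.disjoint_left.1 (hc hne) hm hn
  refine ⟨fun k => (lab k).1, A, fun k => ?_, fun k => (hci _ _).mono fun x hx => hx.2.1,
    fun k => (hdi _ _).mono fun x hx => hx.2.2, fun k x hx => ?_, fun j x hx => ?_, ?_⟩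
  · exact (MeasurableSet.const _).inter ((hcm _ _).inter (hdm _ _))
  · rw [← hcS]
    exact Set.mem_iUnion.2 ⟨_, hx.2.1⟩
  · obtain ⟨m, hm⟩ := Set.mem_iUnion.1 ((hcS j).symm ▸ hx)
    obtain ⟨n, hn⟩ := Set.mem_iUnion.1 ((hdS j).symm ▸ hx)
    refine ⟨e (j, m, n), by simp only [hlab], ?_⟩
    simp only [A, Set.mem_ofPred_eq, hlab]
    exact ⟨trivial, hm, hn⟩
  · rintro k k' x ⟨hk, hxc, hxd⟩ ⟨hk', hxc', hxd'⟩ hj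
    rw [← hk, ← hk']
    change (lab k).1 = (lab k').1 at hj
    rw [← hj] at hxc' hxd'
    exact congrArg e (Prod.ext hj (Prod.ext (huniq (hcd _) hxc hxc') (huniq (hdd _) hxd hxd')))

end Graphings

section Edges

variable {X J : Type} {r : J → X → X → Prop} {U : Set X} {p : J → X → X} {S : J → Set X} {j₀ : J}

/-- Partial isomorphisms following disjoint families of edges form a treeing. -/
theorem RetractionData.isTreeing [MeasurableSpace X] (h : RetractionData r U p S j₀)
    (hfree : ∀ u i, ¬ AltPath r u i u) {ι : Type} {Φ : ι → PBI X} {lab : ι → J} {A : ι → Set X}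
    (hΦ : ∀ k ε a b, PBIStep (Φ k) ε a b → ∃ x ∈ A k, edgeStep p S j₀ (lab k, x, ε) a b)
    (hA : ∀ k k' x, x ∈ A k → x ∈ A k' → lab k = lab k' → k = k') : IsTreeing Φ := by
  intro n i ε x hn hx hstep
  by_contra! hcon
  obtain ⟨n, rfl⟩ : ∃ m, n = m + 1 := ⟨n - 1, by omega⟩
  have hz : ∀ k, ∃ z, k < n + 1 → z ∈ A (i k) ∧
      edgeStep p S j₀ (lab (i k), z, ε k) (x k) (x (k + 1)) := by
    intro k
    by_cases hk : k < n + 1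
    · obtain ⟨z, hz⟩ := hΦ _ _ _ _ (hstep k hk)
      exact ⟨z, fun _ => hz⟩
    · exact ⟨x k, fun h => absurd h hk⟩
  choose z hz using hz
  have hp := RedPath.of_seq (step := edgeStep p S j₀) (ok := EdgeOk) (x := x)
    (i := fun k => (lab (i k), z k, ε k)) (n := n) (fun k hk => (hz k hk).2) (by
      rintro k hk ⟨hlab, hzz, hε⟩
      refine hε (hcon k (by omega) (hA _ _ (z k) (hz k (by omega)).1 ?_ hlab))
      rw [show z k = z (k + 1) from hzz]
      exact (hz (k + 1) (by omega)).1)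
  rw [hx] at hp
  exact h.not_redPath_self hfree _ (.append_edges (.inl rfl) hp)

theorem edgeStep_reverse {a b : X} (h : ∃ e, edgeStep p S j₀ e a b) :
    ∃ e, edgeStep p S j₀ e b a := by
  obtain ⟨⟨j, x, _ | _⟩, h⟩ := h
  · exact ⟨(j, x, true), h.1, h.2.2, h.2.1⟩
  · exact ⟨(j, x, false), h.1, h.2.2, h.2.1⟩

end Edges

/-- If `R = *ⱼ Rⱼ` with `D(R_{j₀}) = D(R)` and `U` is a complete section for
every factor `Rⱼ`, then `R|U = (*ⱼ Rⱼ|U) * T` for some treeable subrelation `T`. -/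
theorem restriction_of_free_product_to_common_complete_section
    {X : Type} [MeasurableSpace X] [StandardBorelSpace X]
    {J : Type} [Countable J]
    (R : CBER X) (Rf : J → CBER X)
    (hfp : IsFreeProduct R Rf)
    (j₀ : J) (hj₀ : (Rf j₀).dom = R.dom)
    (U : Set X) (hU : MeasurableSet U)
    (hsec : ∀ j, (Rf j).IsCompleteSection U) :
    ∃ T : CBER X, T.Treeable ∧ T.IsSubrelOf (R.restrict U hU) ∧
      IsFreeProduct (R.restrict U hU)
        (fun i : Option J => i.elim T (fun j => (Rf j).restrict U hU)) := by
  have : Nonempty J := ⟨j₀⟩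
  choose p hpm hpU hp using fun j => (hsec j).exists_retraction
  have hsub : ∀ j, (Rf j).dom ⊆ (Rf j₀).dom := fun j => by
    rw [hj₀, hfp.2.1]
    exact Set.subset_iUnion (fun j => (Rf j).dom) j
  have hrel : ∀ {j a b}, (Rf j).rel a b → R.rel a b := fun {j a b} hab =>
    (hfp.2.2 a b).2 ⟨hj₀ ▸ hsub j ((Rf j).rel_dom hab).1, .rel _ _ ⟨j, hab⟩⟩
  let S : J → Set X := fun j => {x | j ≠ j₀ ∧ x ∈ (Rf j).dom \ U}
  have hS : ∀ j, MeasurableSet (S j) := fun j =>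
    (MeasurableSet.const _).inter ((Rf j).dom_meas.diff hU)
  have hdata : RetractionData (fun j => (Rf j).rel) U p S j₀ :=
    { symm := fun {j a b} => (Rf j).symm
      trans := fun {j a b c} => (Rf j).trans
      not_mem := fun hx => hx.2.2
      ne := fun hx => hx.1
      rel := fun {j x} hx => (hp j x hx.2.1).1
      rel₀ := fun {j x} hx => (hp j₀ x (hsub j hx.2.1)).1
      mem := fun {j x} hx => (hp j x hx.2.1).2
      mem₀ := fun {j x} hx => (hp j₀ x (hsub j hx.2.1)).2 }
  have hfree := hfp.1.not_altPath_self
  obtain ⟨lab, A, hAm, hAi₀, hAi, hAS, hSA, hAuniq⟩ := exists_pieces_injOn (hpm j₀) hpm hS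
    (fun j x => ((Rf j₀).countable_classes x).mono fun y hy =>
      hy.2 ▸ (Rf j₀).symm (hdata.rel₀ hy.1))
    fun j x => ((Rf j).countable_classes x).mono fun y hy => hy.2 ▸ (Rf j).symm (hdata.rel hy.1)
  choose Φ hsrc htgt hto hinv using fun k =>
    exists_PBI_of_injOn (hpm j₀) (hpm (lab k)) (hAm k) (hAi₀ k) (hAi k)
  have hΦ : ∀ k ε a b, PBIStep (Φ k) ε a b →
      ∃ x ∈ A k, edgeStep p S j₀ (lab k, x, ε) a b := by
    rintro k (_ | _) a b ⟨ha, rfl⟩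
    · rw [htgt] at ha
      obtain ⟨x, hx, rfl⟩ := ha
      exact ⟨x, hx, hAS k hx, rfl, (hinv k x hx).symm⟩
    · rw [hsrc] at ha
      obtain ⟨x, hx, rfl⟩ := ha
      exact ⟨x, hx, hAS k hx, rfl, (hto k x hx).symm⟩
  have hpseudo : ∀ k, (R.restrict U hU).InPseudogroup (Φ k) := by
    have key : ∀ k, ∀ a ∈ (Φ k).src, (R.restrict U hU).rel a ((Φ k).toFun a) := by
      intro k a ha
      obtain ⟨x, -, hx, rfl, hb⟩ := hΦ k true a _ ⟨ha, rfl⟩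
      rw [← hb]
      exact ⟨R.trans (R.symm (hrel (hdata.rel₀ hx))) (hrel (hdata.rel hx)), hdata.mem₀ hx,
        hdata.mem hx⟩
    exact fun k => ⟨fun a ha => ((R.restrict U hU).rel_dom (key k a ha)).1, key k⟩
  obtain ⟨T, hT, hTR⟩ := exists_generatesCBER Φ _ hpseudo
  refine ⟨T, ⟨Φ, hdata.isTreeing hfree hΦ hAuniq, hT⟩, hTR, ?_, ?_, fun a b => ⟨?_, ?_⟩⟩
  · refine freelyIndep_of_not_altPath_self fun u i =>
      hdata.not_altPath_option_self hfree (t := T.rel) (fun a b hab => ?_) (fun _ _ h => h)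
        (fun _ _ _ h => h) i
    refine ((hT.2.2 a b).1 hab).2.reflTransGen_of_le edgeStep_reverse ?_
    rintro a b ⟨k, h⟩
    obtain ⟨x, -, hx⟩ := hΦ k true a b h
    exact ⟨_, hx⟩
  · refine Set.Subset.antisymm (fun x hx => Set.mem_iUnion.2 ⟨some j₀, hj₀ ▸ hx.1, hx.2⟩)
      (Set.iUnion_subset ?_)
    rintro (_ | j)
    · exact hTR.1
    · exact fun x hx => ⟨hj₀ ▸ hsub j hx.1, hx.2⟩
  · rintro ⟨hab, ha, hb⟩
    refine ⟨⟨(R.rel_dom hab).1, ha⟩, ?_⟩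
    set G : X → X → Prop := fun a b =>
      ∃ i : Option J, (i.elim T fun j => (Rf j).restrict U hU).rel a b
    have hedge : ∀ j, ∀ x ∈ (Rf j).dom, j ≠ j₀ → Relation.EqvGen G (p j₀ x) (p j x) := by
      intro j x hx hj
      by_cases hxU : x ∈ U
      · rw [hpU j₀ x hxU, hpU j x hxU]
        exact .refl x
      · obtain ⟨k, rfl, hk⟩ := hSA j x ⟨hj, hx, hxU⟩
        refine .rel _ _ ⟨none, ?_⟩
        rw [← hto k x hk]
        exact (hT.2.1 k).2 _ (hsrc k ▸ Set.mem_image_of_mem _ hk)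
    have hmove : ∀ {j a b}, (Rf j).rel a b → Relation.EqvGen G (p j a) (p j b) := by
      intro j a b hab
      obtain ⟨ha, hb⟩ := (Rf j).rel_dom hab
      exact .rel _ _ ⟨some j, (Rf j).trans ((Rf j).symm (hp j a ha).1)
        ((Rf j).trans hab (hp j b hb).1), (hp j a ha).2, (hp j b hb).2⟩
    have hgen : ∀ {a b}, Relation.EqvGen (fun a b => ∃ j, (Rf j).rel a b) a b →
        Relation.EqvGen G (p j₀ a) (p j₀ b) := by
      intro a b h
      induction h with
      | rel a b h =>
        obtain ⟨j, hab⟩ := h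
        by_cases hj : j = j₀
        · exact hj ▸ hmove hab
        · obtain ⟨ha, hb⟩ := (Rf j).rel_dom hab
          exact .trans _ _ _ (hedge j a ha hj)
            (.trans _ _ _ (hmove hab) (.symm _ _ (hedge j b hb hj)))
      | refl => exact .refl _
      | symm _ _ _ ih => exact .symm _ _ ih
      | trans _ _ _ _ _ ih ih' => exact .trans _ _ _ ih ih'
    have := hgen ((hfp.2.2 a b).1 hab).2
    rwa [hpU j₀ a ha, hpU j₀ b hb] at this
  · rintro ⟨ha, hab⟩
    have hstep : ∀ {a b}, (∃ i : Option J, (i.elim T fun j => (Rf j).restrict U hU).rel a b) →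
        (R.restrict U hU).rel a b := by
      rintro a b ⟨_ | j, h⟩
      · exact hTR.2 a b h
      · exact ⟨hrel h.1, h.2⟩
    have h := hab.reflTransGen_of_le (R.restrict U hU).symm fun _ _ => hstep
    clear hab
    induction h with
    | refl => exact (R.restrict U hU).refl a ha
    | tail _ h ih => exact (R.restrict U hU).trans ih h
end
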